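/- The common information under the total variation distance measure satisfies T_ε^TV(π_{XY}) = C_Wyner(X;Y) for every ε ∈ [0,1), and T_1^TV(π_{XY}) = 0, where T_ε^TV(π_{XY}) := inf{ R ≥ 0 : there exists a sequence of synthesis codes of rate R with limsup_{n→∞} |P_{X^nY^n} − π_{X^nY^n}| ≤ ε }. In particular, the strong converse property holds: T_ε^TV does not depend on ε ∈ [0,1). -/

import Mathlib

open Filter

noncomputable section

/-- `P` is a probability mass function on the finite type `α`. -/
def IsPMF {α : Type*} [Fintype α] (P : α → ℝ) : Prop :=
  (∀ a, 0 ≤ P a) ∧ (∑ a, P a) = 1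

/-- Rényi divergence of order `1 + s` (natural logarithm), `EReal`-valued.
For `s ≥ 0` it is `⊤` when `supp P ⊄ supp Q`; for `s = 0` it is the relative
entropy; otherwise it is `(1/s) log ∑_{x ∈ supp P} P(x)^{1+s} Q(x)^{-s}`. -/
def renyiDiv {α : Type*} [Fintype α] (s : ℝ) (P Q : α → ℝ) : EReal :=
  if 0 ≤ s ∧ ∃ a, 0 < P a ∧ Q a = 0 then ⊤
  else if s = 0 then
    (((∑ a ∈ Finset.univ.filter (fun a => 0 < P a), P a * Real.log (P a / Q a)) : ℝ) : EReal)
  else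
    ((((1 / s) * Real.log (∑ a ∈ Finset.univ.filter (fun a => 0 < P a),
        P a ^ (1 + s) * Q a ^ (-s))) : ℝ) : EReal)

/-- Mutual information `I(XY; W)` of a joint distribution on `(X × Y) × W`. -/
def mutualInfoW {X Y W : Type*} [Fintype X] [Fintype Y] [Fintype W] (P : X × Y × W → ℝ) : ℝ :=
  ∑ z ∈ Finset.univ.filter (fun z : X × Y × W => 0 < P z),
    P z * Real.log (P z /
      ((∑ w, P (z.1, z.2.1, w)) * (∑ p : X × Y, P (p.1, p.2, z.2.2))))

/-- The Markov chain condition `X − W − Y`. -/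
def IsMarkovXWY {X Y W : Type*} [Fintype X] [Fintype Y] [Fintype W] (P : X × Y × W → ℝ) : Prop :=
  ∀ x y w, P (x, y, w) * (∑ p : X × Y, P (p.1, p.2, w)) =
    (∑ y', P (x, y', w)) * (∑ x', P (x', y, w))

/-- Wyner's common information of the target distribution `π` on `X × Y`. -/
def CWyner {X Y : Type*} [Fintype X] [Fintype Y] (π : X × Y → ℝ) : ℝ :=
  sInf { r | ∃ P : X × Y × Fin (Fintype.card X * Fintype.card Y) → ℝ,
    IsPMF P ∧ (∀ x y, (∑ w, P (x, y, w)) = π (x, y)) ∧ IsMarkovXWY P ∧ r = mutualInfoW P }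

/-- The message set size `⌈e^{nR}⌉` of a rate-`R` synthesis code at blocklength `n`. -/
def numMsgs (R : ℝ) (n : ℕ) : ℕ := ⌈Real.exp (n * R)⌉₊

/-- A synthesis code: a pair of conditional distributions from the message set to
`X^n` and `Y^n` respectively. -/
structure SynthCode (X Y : Type*) [Fintype X] [Fintype Y] (M n : ℕ) where
  PX : Fin M → (Fin n → X) → ℝ
  PY : Fin M → (Fin n → Y) → ℝ
  PX_pmf : ∀ m, IsPMF (PX m)
  PY_pmf : ∀ m, IsPMF (PY m)

/-- The distribution `P_{X^n Y^n}` induced by a synthesis code. -/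
def SynthCode.induced {X Y : Type*} [Fintype X] [Fintype Y] {M n : ℕ}
    (c : SynthCode X Y M n) : (Fin n → X) × (Fin n → Y) → ℝ :=
  fun z => (M : ℝ)⁻¹ * ∑ m, c.PX m z.1 * c.PY m z.2

/-- The `n`-fold product distribution `π^{⊗ n}` on `X^n × Y^n`. -/
def prodDist {X Y : Type*} [Fintype X] [Fintype Y] (π : X × Y → ℝ) (n : ℕ) :
    (Fin n → X) × (Fin n → Y) → ℝ :=
  fun z => ∏ i, π (z.1 i, z.2 i)

/-- Total variation distance between two distributions on a finite type. -/
def tvDist {α : Type*} [Fintype α] (P Q : α → ℝ) : ℝ :=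
  (∑ a, |P a - Q a|) / 2

/-- The common information under the total variation distance measure,
with approximation level `ε`. -/
def Ttv {X Y : Type*} [Fintype X] [Fintype Y] (π : X × Y → ℝ) (ε : ℝ) : ℝ :=
  sInf { R : ℝ | 0 ≤ R ∧ ∃ c : (n : ℕ) → SynthCode X Y (numMsgs R n) n,
    Filter.limsup (fun n => tvDist ((c n).induced) (prodDist π n)) atTop ≤ ε }

open Real (negMulLog)

/-- The pointwise Gibbs inequality. -/
lemma sub_le_mul_log_sub {q t : ℝ} (hq : 0 ≤ q) (ht : 0 ≤ t) (h : t = 0 → q = 0) :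
    q - t ≤ q * Real.log q - q * Real.log t := by
  rcases hq.eq_or_lt with rfl | hq
  · simpa using ht
  have ht' : 0 < t := lt_of_le_of_ne ht fun h0 => hq.ne' (h h0.symm)
  have h1 := Real.log_le_sub_one_of_pos (div_pos ht' hq)
  rw [Real.log_div ht'.ne' hq.ne'] at h1
  have h2 := mul_le_mul_of_nonneg_left h1 hq.le
  have h3 : q * (t / q - 1) = t - q := by field_simp
  nlinarith

lemma eq_of_mul_log_sub_le {q t : ℝ} (hq : 0 ≤ q) (ht : 0 ≤ t) (h : t = 0 → q = 0)
    (hle : q * Real.log q - q * Real.log t ≤ q - t) : q = t := by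
  rcases hq.eq_or_lt with rfl | hq
  · simp at hle; linarith
  have ht' : 0 < t := lt_of_le_of_ne ht fun h0 => hq.ne' (h h0.symm)
  by_contra hne
  have h1 := Real.log_lt_sub_one_of_pos (div_pos ht' hq)
    (fun h => hne ((div_eq_one_iff_eq hq.ne').1 h).symm)
  rw [Real.log_div ht'.ne' hq.ne'] at h1
  have h2 := mul_lt_mul_of_pos_left h1 hq
  have h3 : q * (t / q - 1) = t - q := by field_simp
  nlinarith

/-- Gibbs' inequality. -/
lemma sum_negMulLog_le {α : Type*} [Fintype α] {q t : α → ℝ} (hq : ∀ a, 0 ≤ q a)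
    (ht : ∀ a, 0 ≤ t a) (h : ∀ a, t a = 0 → q a = 0) (hs : ∑ a, t a ≤ ∑ a, q a) :
    ∑ a, negMulLog (q a) ≤ - ∑ a, q a * Real.log (t a) := by
  have := Finset.sum_le_sum fun a (_ : a ∈ Finset.univ) => sub_le_mul_log_sub (hq a) (ht a) (h a)
  simp only [Finset.sum_sub_distrib] at this
  simp only [negMulLog, neg_mul, Finset.sum_neg_distrib]
  linarith

lemma eq_of_le_sum_negMulLog {α : Type*} [Fintype α] {q t : α → ℝ} (hq : ∀ a, 0 ≤ q a)
    (ht : ∀ a, 0 ≤ t a) (h : ∀ a, t a = 0 → q a = 0) (hs : ∑ a, t a = ∑ a, q a)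
    (hle : - ∑ a, q a * Real.log (t a) ≤ ∑ a, negMulLog (q a)) : q = t := by
  have h1 : ∀ a ∈ Finset.univ, q a - t a ≤ q a * Real.log (q a) - q a * Real.log (t a) :=
    fun a _ => sub_le_mul_log_sub (hq a) (ht a) (h a)
  have h2 : ∑ a, (q a - t a) = ∑ a, (q a * Real.log (q a) - q a * Real.log (t a)) := by
    refine le_antisymm (Finset.sum_le_sum h1) ?_
    simp only [negMulLog, neg_mul, Finset.sum_neg_distrib] at hle
    simp only [Finset.sum_sub_distrib]
    linarith
  funext a
  exact eq_of_mul_log_sub_le (hq a) (ht a) (h a)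
    ((Finset.sum_eq_sum_iff_of_le h1).1 h2 a (Finset.mem_univ a)).ge

/-- The entropy of a finite measure, extended homogeneously from probability measures. -/
def entropy {α : Type*} [Fintype α] (q : α → ℝ) : ℝ :=
  ∑ a, negMulLog (q a) - negMulLog (∑ a, q a)

/-- The mutual information of a finite measure on a product, extended homogeneously. -/
def mutualInfo {α β : Type*} [Fintype α] [Fintype β] (q : α × β → ℝ) : ℝ :=
  ∑ a, negMulLog (∑ b, q (a, b)) + ∑ b, negMulLog (∑ a, q (a, b))
    - ∑ z, negMulLog (q z) - negMulLog (∑ z, q z)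

lemma entropy_smul {α : Type*} [Fintype α] (t : ℝ) (q : α → ℝ) :
    entropy (t • q) = t * entropy q := by
  simp only [entropy, Pi.smul_apply, smul_eq_mul, Real.negMulLog_mul, ← Finset.mul_sum,
    Finset.sum_add_distrib, ← Finset.sum_mul]
  ring

lemma mutualInfo_smul {α β : Type*} [Fintype α] [Fintype β] (t : ℝ) (q : α × β → ℝ) :
    mutualInfo (t • q) = t * mutualInfo q := by
  simp only [mutualInfo, Pi.smul_apply, smul_eq_mul, Real.negMulLog_mul, ← Finset.mul_sum,
    Finset.sum_add_distrib, ← Finset.sum_mul, Fintype.sum_prod_type]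
  rw [Finset.sum_comm (f := fun b a => q (a, b))]
  ring

lemma continuous_entropy {α : Type*} [Fintype α] : Continuous (entropy : (α → ℝ) → ℝ) := by
  have := Real.continuous_negMulLog
  unfold entropy
  fun_prop

lemma continuous_mutualInfo {α β : Type*} [Fintype α] [Fintype β] :
    Continuous (mutualInfo : (α × β → ℝ) → ℝ) := by
  have := Real.continuous_negMulLog
  unfold mutualInfo
  fun_prop

lemma entropy_comp_equiv {α β : Type*} [Fintype α] [Fintype β] (e : α ≃ β) (q : β → ℝ) :
    entropy (fun a => q (e a)) = entropy q := by
  simp only [entropy]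
  rw [e.sum_comp q, e.sum_comp fun b => negMulLog (q b)]

lemma mutualInfo_comp_equiv {α β γ δ : Type*} [Fintype α] [Fintype β] [Fintype γ] [Fintype δ]
    (e : α ≃ γ) (f : β ≃ δ) (q : γ × δ → ℝ) :
    mutualInfo (fun z : α × β => q (e z.1, f z.2)) = mutualInfo q := by
  have h1 := (e.prodCongr f).sum_comp q
  have h2 := (e.prodCongr f).sum_comp fun z => negMulLog (q z)
  simp only [Equiv.prodCongr_apply, Prod.map] at h1 h2
  simp only [mutualInfo]
  rw [h1, h2, ← e.sum_comp fun a => negMulLog (∑ b, q (a, b)),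
    ← f.sum_comp fun b => negMulLog (∑ a, q (a, b))]
  simp only [fun a => f.sum_comp fun b => q (a, b), fun b => e.sum_comp fun a => q (a, b)]

/-- The product of the marginals of a finite measure, scaled to the same total mass. -/
lemma prod_marginals_facts {α β : Type*} [Fintype α] [Fintype β] {q : α × β → ℝ}
    (hq : ∀ z, 0 ≤ q z) :
    (∀ z : α × β, 0 ≤ (∑ b, q (z.1, b)) * (∑ a, q (a, z.2)) / ∑ z, q z) ∧
    (∀ z : α × β, (∑ b, q (z.1, b)) * (∑ a, q (a, z.2)) / ∑ z, q z = 0 → q z = 0) ∧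
    (∑ z : α × β, (∑ b, q (z.1, b)) * (∑ a, q (a, z.2)) / ∑ z, q z = ∑ z, q z) ∧
    - ∑ z : α × β, q z * Real.log ((∑ b, q (z.1, b)) * (∑ a, q (a, z.2)) / ∑ z, q z) =
      mutualInfo q + ∑ z, negMulLog (q z) := by
  have hA : ∀ z : α × β, q z ≤ ∑ b, q (z.1, b) := fun z =>
    Finset.single_le_sum (f := fun b => q (z.1, b)) (fun _ _ => hq _) (Finset.mem_univ z.2)
  have hB : ∀ z : α × β, q z ≤ ∑ a, q (a, z.2) := fun z =>
    Finset.single_le_sum (f := fun a => q (a, z.2)) (fun _ _ => hq _) (Finset.mem_univ z.1)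
  have hT : ∀ z : α × β, q z ≤ ∑ z, q z := fun z =>
    Finset.single_le_sum (f := q) (fun _ _ => hq _) (Finset.mem_univ z)
  have hT0 : 0 ≤ ∑ z, q z := Finset.sum_nonneg fun _ _ => hq _
  have hsA : ∑ a, ∑ b, q (a, b) = ∑ z, q z := (Fintype.sum_prod_type q).symm
  have hsB : ∑ b, ∑ a, q (a, b) = ∑ z, q z := by rw [Finset.sum_comm, hsA]
  refine ⟨fun z => ?_, fun z h => ?_, ?_, ?_⟩
  · have := hA z; have := hB z; have := hq z
    exact div_nonneg (mul_nonneg (by linarith) (by linarith)) hT0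
  · by_contra hne
    have hpos : 0 < q z := lt_of_le_of_ne (hq z) (Ne.symm hne)
    have : 0 < (∑ b, q (z.1, b)) * (∑ a, q (a, z.2)) / ∑ z, q z :=
      div_pos (mul_pos (hpos.trans_le (hA z)) (hpos.trans_le (hB z))) (hpos.trans_le (hT z))
    exact this.ne' h
  · rw [← Finset.sum_div, Fintype.sum_prod_type]
    simp only [← Finset.mul_sum, ← Finset.sum_mul]
    rw [hsA, hsB, mul_self_div_self]
  · have h1 : ∀ z : α × β, q z * Real.log ((∑ b, q (z.1, b)) * (∑ a, q (a, z.2)) / ∑ z, q z) =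
        q z * Real.log (∑ b, q (z.1, b)) + q z * Real.log (∑ a, q (a, z.2))
          - q z * Real.log (∑ z, q z) := by
      intro z
      rcases (hq z).eq_or_lt with h0 | hpos
      · simp [← h0]
      · rw [Real.log_div (mul_pos (hpos.trans_le (hA z)) (hpos.trans_le (hB z))).ne'
          (hpos.trans_le (hT z)).ne', Real.log_mul (hpos.trans_le (hA z)).ne'
          (hpos.trans_le (hB z)).ne']
        ring
    simp only [h1, Finset.sum_sub_distrib, Finset.sum_add_distrib]
    have h2 : ∑ z : α × β, q z * Real.log (∑ b, q (z.1, b)) =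
        - ∑ a, negMulLog (∑ b, q (a, b)) := by
      simp [Fintype.sum_prod_type, negMulLog, ← Finset.sum_mul]
    have h3 : ∑ z : α × β, q z * Real.log (∑ a, q (a, z.2)) =
        - ∑ b, negMulLog (∑ a, q (a, b)) := by
      simp [Fintype.sum_prod_type_right, negMulLog, ← Finset.sum_mul]
    rw [h2, h3, ← Finset.sum_mul, mutualInfo]
    simp only [negMulLog]
    ring

lemma mutualInfo_nonneg {α β : Type*} [Fintype α] [Fintype β] {q : α × β → ℝ}
    (hq : ∀ z, 0 ≤ q z) : 0 ≤ mutualInfo q := by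
  obtain ⟨h1, h2, h3, h4⟩ := prod_marginals_facts hq
  have := sum_negMulLog_le hq h1 h2 h3.le
  linarith

lemma eq_prod_of_mutualInfo_le {α β : Type*} [Fintype α] [Fintype β] {q : α × β → ℝ}
    (hq : ∀ z, 0 ≤ q z) (hs : ∑ z, q z = 1) (h : mutualInfo q ≤ 0) (z : α × β) :
    q z = (∑ b, q (z.1, b)) * ∑ a, q (a, z.2) := by
  obtain ⟨h1, h2, h3, h4⟩ := prod_marginals_facts hq
  have := congrFun (eq_of_le_sum_negMulLog hq h1 h2 h3 (by linarith)) z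
  rwa [hs, div_one] at this

/-- The entropy of a marginal plus the conditional entropy is the joint entropy. -/
lemma entropy_chain {α β : Type*} [Fintype α] [Fintype β] (q : α × β → ℝ) :
    entropy q = entropy (fun a => ∑ b, q (a, b)) + ∑ a, entropy fun b => q (a, b) := by
  simp only [entropy, Fintype.sum_prod_type, Finset.sum_sub_distrib]
  ring

lemma mutualInfo_chain {α β γ δ : Type*} [Fintype α] [Fintype β] [Fintype γ] [Fintype δ]
    {q : (α × γ) × (β × δ) → ℝ} (hq : ∀ z, 0 ≤ q z) :
    mutualInfo (fun z : α × β => ∑ c, ∑ d, q ((z.1, c), (z.2, d))) +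
      ∑ z : α × β, mutualInfo (fun w : γ × δ => q ((z.1, w.1), (z.2, w.2))) ≤ mutualInfo q := by
  have h1 : ∀ a, 0 ≤ mutualInfo (fun w : γ × β => ∑ d, q ((a, w.1), (w.2, d))) := fun a =>
    mutualInfo_nonneg fun _ => Finset.sum_nonneg fun _ _ => hq _
  have h2 : ∀ b, 0 ≤ mutualInfo (fun w : α × δ => ∑ c, q ((w.1, c), (b, w.2))) := fun b =>
    mutualInfo_nonneg fun _ => Finset.sum_nonneg fun _ _ => hq _
  have h3 := Finset.sum_nonneg fun a (_ : a ∈ Finset.univ) => h1 a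
  have h4 := Finset.sum_nonneg fun b (_ : b ∈ Finset.univ) => h2 b
  simp only [mutualInfo, Fintype.sum_prod_type, Finset.sum_sub_distrib,
    Finset.sum_add_distrib] at h3 h4 ⊢
  have e1 : ∀ a, ∑ b, ∑ c, ∑ d, q ((a, c), (b, d)) = ∑ c, ∑ b, ∑ d, q ((a, c), (b, d)) :=
    fun a => Finset.sum_comm
  have e3 : ∀ a b, ∑ d, ∑ c, q ((a, c), (b, d)) = ∑ c, ∑ d, q ((a, c), (b, d)) :=
    fun a b => Finset.sum_comm
  have e4 : ∑ b, ∑ a, ∑ d, negMulLog (∑ c, q ((a, c), (b, d))) =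
      ∑ a, ∑ b, ∑ d, negMulLog (∑ c, q ((a, c), (b, d))) := Finset.sum_comm
  have e5 : ∀ a, ∑ c, ∑ b, negMulLog (∑ d, q ((a, c), (b, d))) =
      ∑ b, ∑ c, negMulLog (∑ d, q ((a, c), (b, d))) := fun a => Finset.sum_comm
  have e6 : ∀ a, ∑ b, ∑ c, ∑ d, negMulLog (q ((a, c), (b, d))) =
      ∑ c, ∑ b, ∑ d, negMulLog (q ((a, c), (b, d))) := fun a => Finset.sum_comm
  have e7 : ∑ b, ∑ a, negMulLog (∑ c, ∑ d, q ((a, c), (b, d))) =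
      ∑ a, ∑ b, negMulLog (∑ c, ∑ d, q ((a, c), (b, d))) := Finset.sum_comm
  simp only [e1, e3, e4, e5, e6, e7] at h3 h4 ⊢
  linarith

/-- A finite combination with nonnegative weights can be supported on at most `finrank` points
without changing the combined vector and without decreasing a given objective. -/
lemma exists_subset_card_le_finrank {E ι : Type*} [AddCommGroup E] [Module ℝ E]
    [FiniteDimensional ℝ E] (ℓ : E →ₗ[ℝ] ℝ) (v : ι → E) (f : ι → ℝ) (hℓ : ∀ i, ℓ (v i) = 1)
    (n : ℕ) : ∀ (s : Finset ι) (w : ι → ℝ), s.card ≤ n → (∀ i ∈ s, 0 ≤ w i) →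
      ∃ (s' : Finset ι) (w' : ι → ℝ), s'.card ≤ Module.finrank ℝ E ∧ (∀ i ∈ s', 0 ≤ w' i) ∧
        ∑ i ∈ s', w' i • v i = ∑ i ∈ s, w i • v i ∧
        ∑ i ∈ s, w i * f i ≤ ∑ i ∈ s', w' i * f i := by
  classical
  induction n with
  | zero =>
    intro s w hs hw
    exact ⟨s, w, hs.trans (Nat.zero_le _), hw, rfl, le_rfl⟩
  | succ n ih =>
    intro s w hs hw
    by_cases hcard : s.card ≤ Module.finrank ℝ E
    · exact ⟨s, w, hcard, hw, rfl, le_rfl⟩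
    obtain ⟨c, hc0, i₁, hi₁, hci₁⟩ : ∃ c : ι → ℝ, ∑ i ∈ s, c i • v i = 0 ∧ ∃ i ∈ s, c i ≠ 0 := by
      by_contra! hcon
      have hli : LinearIndepOn ℝ v (s : Set ι) := linearIndepOn_finset_iff.2 hcon
      have := LinearIndependent.fintype_card_le_finrank hli
      simp only [Finset.coe_sort_coe, Fintype.card_coe] at this
      exact hcard this
    wlog hcf : 0 ≤ ∑ i ∈ s, c i * f i generalizing c
    · refine this (-c) ?_ ?_ ?_
      · simpa [Finset.sum_neg_distrib] using hc0
      · simpa using hci₁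
      · simp only [Pi.neg_apply, neg_mul, Finset.sum_neg_distrib]
        linarith
    have hcs : ∑ i ∈ s, c i = 0 := by
      have := congrArg ℓ hc0
      simpa [map_sum, hℓ] using this
    have hneg : (s.filter fun i => c i < 0).Nonempty := by
      by_contra hcon
      rw [Finset.not_nonempty_iff_eq_empty, Finset.filter_eq_empty_iff] at hcon
      have := (Finset.sum_eq_zero_iff_of_nonneg fun i hi => not_lt.1 (hcon hi)).1 hcs
      exact hci₁ (this i₁ hi₁)
    obtain ⟨i₀, hi₀, hmin⟩ := Finset.exists_min_image _ (fun i => w i / -c i) hneg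
    rw [Finset.mem_filter] at hi₀
    set θ := w i₀ / -c i₀ with hθ
    have hθ0 : 0 ≤ θ := div_nonneg (hw _ hi₀.1) (by linarith [hi₀.2])
    have hz : w i₀ + θ * c i₀ = 0 := by
      have : c i₀ ≠ 0 := hi₀.2.ne
      rw [hθ]; field_simp; ring
    have hw' : ∀ i ∈ s, 0 ≤ w i + θ * c i := by
      intro i hi
      rcases lt_or_ge (c i) 0 with h | h
      · have h1 := hmin i (Finset.mem_filter.2 ⟨hi, h⟩)
        rw [le_div_iff₀ (by linarith)] at h1
        linarith
      · have := hw i hi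
        positivity
    obtain ⟨s', w', h1, h2, h3, h4⟩ := ih (s.erase i₀) (fun i => w i + θ * c i)
      (by rw [Finset.card_erase_of_mem hi₀.1]; omega)
      fun i hi => hw' i (Finset.mem_of_mem_erase hi)
    refine ⟨s', w', h1, h2, h3.trans ?_, le_trans ?_ h4⟩
    · rw [Finset.sum_erase _ (by rw [hz, zero_smul])]
      simp only [add_smul, Finset.sum_add_distrib, mul_smul, ← Finset.smul_sum, hc0, smul_zero,
        add_zero]
    · rw [Finset.sum_erase _ (by rw [hz, zero_mul])]
      simp only [add_mul, Finset.sum_add_distrib, mul_assoc, ← Finset.mul_sum]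
      have := mul_nonneg hθ0 hcf
      linarith

lemma exists_fin_finrank {E T ι : Type*} [AddCommGroup E] [Module ℝ E]
    [FiniteDimensional ℝ E] [Fintype ι] (ℓ : E →ₗ[ℝ] ℝ) (v : T → E) (f : T → ℝ)
    (hℓ : ∀ i, ℓ (v i) = 1) (t : ι → T) (w : ι → ℝ) (hw : ∀ i, 0 ≤ w i) (hw1 : ∑ i, w i = 1) :
    ∃ (t' : Fin (Module.finrank ℝ E) → T) (w' : Fin (Module.finrank ℝ E) → ℝ),
      (∀ i, 0 ≤ w' i) ∧ ∑ i, w' i = 1 ∧ ∑ i, w' i • v (t' i) = ∑ i, w i • v (t i) ∧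
        ∑ i, w i * f (t i) ≤ ∑ i, w' i * f (t' i) := by
  classical
  obtain ⟨s, u, hs, hu, huv, huf⟩ := exists_subset_card_le_finrank ℓ (fun i => v (t i))
    (fun i => f (t i)) (fun i => hℓ _) _ Finset.univ w le_rfl fun i _ => hw i
  obtain ⟨i₀⟩ : Nonempty ι := by
    by_contra h
    rw [not_nonempty_iff] at h
    simp at hw1
  obtain ⟨g⟩ : Nonempty (s ↪ Fin (Module.finrank ℝ E)) :=
    Function.Embedding.nonempty_of_card_le (by simpa using hs)
  have key : ∑ i, Function.extend g (fun i : s => u i) 0 i •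
        (v (Function.extend g (fun i : s => t i) (fun _ => t i₀) i),
          f (Function.extend g (fun i : s => t i) (fun _ => t i₀) i)) =
      ∑ i ∈ s, u i • (v (t i), f (t i)) := by
    rw [← Finset.sum_coe_sort s fun i => u i • (v (t i), f (t i))]
    symm
    refine Fintype.sum_of_injective g g.injective _ _ ?_ ?_
    · intro i hi
      rw [Function.extend_apply' _ _ _ (by simpa [Set.mem_range] using hi)]
      simp
    · intro i
      rw [g.injective.extend_apply, g.injective.extend_apply]
  simp only [Prod.ext_iff, Prod.fst_sum, Prod.snd_sum, Prod.smul_mk, smul_eq_mul] at key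
  obtain ⟨h3, h4⟩ := key
  refine ⟨Function.extend g (fun i : s => t i) (fun _ => t i₀),
    Function.extend g (fun i : s => u i) 0, ?_, ?_, h3.trans huv, ?_⟩
  · intro i
    by_cases h : ∃ a, g a = i
    · obtain ⟨a, rfl⟩ := h
      rw [g.injective.extend_apply]
      exact hu a a.2
    · rw [Function.extend_apply' _ _ _ h]
      simp
  · have := congrArg ℓ (h3.trans huv)
    simpa [map_sum, hℓ, hw1] using this
  · rw [h4]
    exact huf

/-- The convex hull of a compact subset of a hyperplane missing the origin, in finite dimension,
is compact. -/
lemma isCompact_convexHull_of_hyperplane {E : Type*} [NormedAddCommGroup E] [NormedSpace ℝ E]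
    [FiniteDimensional ℝ E] (ℓ : E →ₗ[ℝ] ℝ) {K : Set E} (hK : IsCompact K)
    (hℓ : ∀ x ∈ K, ℓ x = 1) : IsCompact (convexHull ℝ K) := by
  have h : convexHull ℝ K =
      (fun p : (Fin (Module.finrank ℝ E) → ℝ) × (Fin (Module.finrank ℝ E) → E) =>
        ∑ i, p.1 i • p.2 i) '' (stdSimplex ℝ _ ×ˢ Set.univ.pi fun _ => K) := by
    ext x
    constructor
    · intro hx
      obtain ⟨ι, _, w, z, hw, hw1, hz, rfl⟩ := mem_convexHull_iff_exists_fintype.1 hx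
      obtain ⟨t', w', h1, h2, h3, -⟩ := exists_fin_finrank (T := K) ℓ (fun x => (x : E))
        (fun _ => 0) (fun x => hℓ x x.2) (fun i => ⟨z i, hz i⟩) w hw hw1
      exact ⟨(w', fun i => t' i), ⟨⟨h1, h2⟩, fun i _ => (t' i).2⟩, h3⟩
    · rintro ⟨⟨w, z⟩, ⟨⟨h1, h2⟩, h3⟩, rfl⟩
      exact mem_convexHull_iff_exists_fintype.2
        ⟨Fin (Module.finrank ℝ E), inferInstance, w, z, h1, h2, fun i => h3 i trivial, rfl⟩
  rw [h]
  refine ((isCompact_stdSimplex ℝ _).prod (isCompact_univ_pi fun _ => hK)).image ?_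
  fun_prop

/-- The values over which Wyner's common information is minimised. -/
def wynerSet {X Y : Type*} [Fintype X] [Fintype Y] (π : X × Y → ℝ) : Set ℝ :=
  { r | ∃ P : X × Y × Fin (Fintype.card X * Fintype.card Y) → ℝ,
    IsPMF P ∧ (∀ x y, (∑ w, P (x, y, w)) = π (x, y)) ∧ IsMarkovXWY P ∧ r = mutualInfoW P }

lemma mutualInfoW_eq {X Y W : Type*} [Fintype X] [Fintype Y] [Fintype W] {P : X × Y × W → ℝ}
    (hP : ∀ z, 0 ≤ P z) :
    mutualInfoW P = ∑ z : X × Y, negMulLog (∑ w, P (z.1, z.2, w)) +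
      ∑ w, negMulLog (∑ z : X × Y, P (z.1, z.2, w)) -
        ∑ w, ∑ z : X × Y, negMulLog (P (z.1, z.2, w)) := by
  have h1 : ∀ z : X × Y × W, P z ≤ ∑ w, P (z.1, z.2.1, w) := fun z =>
    Finset.single_le_sum (f := fun w => P (z.1, z.2.1, w)) (fun _ _ => hP _) (Finset.mem_univ z.2.2)
  have h2 : ∀ z : X × Y × W, P z ≤ ∑ p : X × Y, P (p.1, p.2, z.2.2) := fun z =>
    Finset.single_le_sum (f := fun p : X × Y => P (p.1, p.2, z.2.2)) (fun _ _ => hP _)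
      (Finset.mem_univ (z.1, z.2.1))
  have h3 : mutualInfoW P = ∑ z : X × Y × W, (P z * Real.log (P z)
      - P z * Real.log (∑ w, P (z.1, z.2.1, w))
      - P z * Real.log (∑ p : X × Y, P (p.1, p.2, z.2.2))) := by
    rw [mutualInfoW, Finset.sum_filter]
    refine Finset.sum_congr rfl fun z _ => ?_
    split_ifs with h
    · rw [Real.log_div h.ne' (mul_pos (h.trans_le (h1 z)) (h.trans_le (h2 z))).ne',
        Real.log_mul (h.trans_le (h1 z)).ne' (h.trans_le (h2 z)).ne']
      ring
    · simp [le_antisymm (not_lt.1 h) (hP z)]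
  rw [h3]
  simp only [Finset.sum_sub_distrib]
  have e1 : ∑ z : X × Y × W, P z * Real.log (∑ w, P (z.1, z.2.1, w)) =
      - ∑ z : X × Y, negMulLog (∑ w, P (z.1, z.2, w)) := by
    simp [Fintype.sum_prod_type, negMulLog, ← Finset.sum_mul]
  have e2 : ∑ z : X × Y × W, P z * Real.log (∑ p : X × Y, P (p.1, p.2, z.2.2)) =
      - ∑ w, negMulLog (∑ z : X × Y, P (z.1, z.2, w)) := by
    rw [← (Equiv.prodAssoc X Y W).sum_comp, Fintype.sum_prod_type_right]
    simp [negMulLog, ← Finset.sum_mul]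
  have e3 : ∑ z : X × Y × W, P z * Real.log (P z) =
      - ∑ w, ∑ z : X × Y, negMulLog (P (z.1, z.2, w)) := by
    rw [← (Equiv.prodAssoc X Y W).sum_comp, Fintype.sum_prod_type_right]
    simp [negMulLog]
  rw [e1, e2, e3]
  ring

/-- The product of two distributions. -/
def prodPMF {X Y : Type*} (A : X → ℝ) (B : Y → ℝ) : X × Y → ℝ := fun z => A z.1 * B z.2

lemma IsPMF.prod {X Y : Type*} [Fintype X] [Fintype Y] {A : X → ℝ} {B : Y → ℝ}
    (hA : IsPMF A) (hB : IsPMF B) : IsPMF (prodPMF A B) := by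
  refine ⟨fun z => mul_nonneg (hA.1 _) (hB.1 _), ?_⟩
  simp [prodPMF, Fintype.sum_prod_type, ← Finset.mul_sum, hB.2, hA.2]

lemma IsPMF.entropy_eq {α : Type*} [Fintype α] {q : α → ℝ} (hq : IsPMF q) :
    entropy q = ∑ a, negMulLog (q a) := by
  simp [entropy, hq.2]

lemma IsPMF.nonempty {α : Type*} [Fintype α] {q : α → ℝ} (hq : IsPMF q) : Nonempty α := by
  by_contra h
  rw [not_nonempty_iff] at h
  have := hq.2
  simp at this

lemma mutualInfoW_mixture {X Y W : Type*} [Fintype X] [Fintype Y] [Fintype W] {p : W → ℝ}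
    {A : W → X → ℝ} {B : W → Y → ℝ} (hp : IsPMF p) (hA : ∀ w, IsPMF (A w))
    (hB : ∀ w, IsPMF (B w)) :
    mutualInfoW (fun z : X × Y × W => p z.2.2 * (A z.2.2 z.1 * B z.2.2 z.2.1)) =
      ∑ z : X × Y, negMulLog (∑ w, p w * prodPMF (A w) (B w) z) -
        ∑ w, p w * entropy (prodPMF (A w) (B w)) := by
  rw [mutualInfoW_eq fun z => mul_nonneg (hp.1 _) (mul_nonneg ((hA _).1 _) ((hB _).1 _))]
  have hs : ∀ w, ∑ z : X × Y, A w z.1 * B w z.2 = 1 := fun w => ((hA w).prod (hB w)).2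
  simp only [Real.negMulLog_mul (p _), Finset.sum_add_distrib, ← Finset.sum_mul, hs,
    ← Finset.mul_sum, ((hA _).prod (hB _)).entropy_eq]
  simp [prodPMF]
  ring

lemma mixture_mem_wynerSet {X Y : Type*} [Fintype X] [Fintype Y] {π : X × Y → ℝ}
    (p : Fin (Fintype.card X * Fintype.card Y) → ℝ)
    (A : Fin (Fintype.card X * Fintype.card Y) → X → ℝ)
    (B : Fin (Fintype.card X * Fintype.card Y) → Y → ℝ) (hp : IsPMF p) (hA : ∀ w, IsPMF (A w))
    (hB : ∀ w, IsPMF (B w)) (h : ∀ z, ∑ w, p w * prodPMF (A w) (B w) z = π z) :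
    ∑ z, negMulLog (π z) - ∑ w, p w * entropy (prodPMF (A w) (B w)) ∈ wynerSet π := by
  refine ⟨fun z => p z.2.2 * (A z.2.2 z.1 * B z.2.2 z.2.1), ⟨?_, ?_⟩, ?_, ?_, ?_⟩
  · exact fun z => mul_nonneg (hp.1 _) (mul_nonneg ((hA _).1 _) ((hB _).1 _))
  · rw [← (Equiv.prodAssoc X Y _).sum_comp, Fintype.sum_prod_type_right]
    have hs : ∀ w, ∑ z : X × Y, A w z.1 * B w z.2 = 1 := fun w => ((hA w).prod (hB w)).2
    simp [← Finset.mul_sum, hs, hp.2]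
  · exact fun x y => h (x, y)
  · intro x y w
    have hs : ∑ z : X × Y, A w z.1 * B w z.2 = 1 := ((hA w).prod (hB w)).2
    simp only [← Finset.mul_sum, hs, (hB w).2, ← Finset.sum_mul, (hA w).2]
    ring
  · rw [mutualInfoW_mixture hp hA hB]
    simp only [h]

lemma isPMF_single {α : Type*} [Fintype α] [DecidableEq α] (a : α) :
    IsPMF (Pi.single a 1 : α → ℝ) := by
  refine ⟨fun b => ?_, by simp⟩
  by_cases h : b = a
  · subst h; simp
  · simp [h]

lemma exists_isPMF (α : Type*) [Fintype α] [h : Nonempty α] : ∃ q : α → ℝ, IsPMF q := by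
  classical
  exact h.elim fun a => ⟨_, isPMF_single a⟩

lemma exists_mixture_of_mem_wynerSet {X Y : Type*} [Fintype X] [Fintype Y] {π : X × Y → ℝ}
    {r : ℝ} (hr : r ∈ wynerSet π) :
    ∃ (p : Fin (Fintype.card X * Fintype.card Y) → ℝ)
      (A : Fin (Fintype.card X * Fintype.card Y) → X → ℝ)
      (B : Fin (Fintype.card X * Fintype.card Y) → Y → ℝ), IsPMF p ∧ (∀ w, IsPMF (A w)) ∧
      (∀ w, IsPMF (B w)) ∧ (∀ z, ∑ w, p w * prodPMF (A w) (B w) z = π z) ∧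
      r = ∑ z, negMulLog (π z) - ∑ w, p w * entropy (prodPMF (A w) (B w)) := by
  classical
  obtain ⟨P, hP, hPπ, hM, rfl⟩ := hr
  have : Nonempty X := hP.nonempty.map fun z => z.1
  have : Nonempty Y := hP.nonempty.map fun z => z.2.1
  obtain ⟨A₀, hA₀⟩ := exists_isPMF X
  obtain ⟨B₀, hB₀⟩ := exists_isPMF Y
  set p : Fin (Fintype.card X * Fintype.card Y) → ℝ := fun w => ∑ z : X × Y, P (z.1, z.2, w) with hp
  have hp0 : ∀ w, 0 ≤ p w := fun w => Finset.sum_nonneg fun _ _ => hP.1 _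
  have hpX : ∀ w, ∑ x, ∑ y, P (x, y, w) = p w := fun w => by
    simp only [hp, Fintype.sum_prod_type]
  have hpY : ∀ w, ∑ y, ∑ x, P (x, y, w) = p w := fun w => by rw [Finset.sum_comm, hpX]
  set A : Fin (Fintype.card X * Fintype.card Y) → X → ℝ :=
    fun w => if p w = 0 then A₀ else fun x => (∑ y, P (x, y, w)) / p w with hA
  set B : Fin (Fintype.card X * Fintype.card Y) → Y → ℝ :=
    fun w => if p w = 0 then B₀ else fun y => (∑ x, P (x, y, w)) / p w with hB
  have hP' : P = fun z : X × Y × _ => p z.2.2 * (A z.2.2 z.1 * B z.2.2 z.2.1) := by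
    funext ⟨x, y, w⟩
    by_cases h : p w = 0
    · have := (Finset.sum_eq_zero_iff_of_nonneg fun _ _ => hP.1 _).1 h (x, y) (Finset.mem_univ _)
      simp [h, this]
    · have := hM x y w
      simp only [hA, hB, h, if_false]
      field_simp
      exact this
  have hpP : IsPMF p := by
    refine ⟨hp0, ?_⟩
    rw [← hP.2, ← (Equiv.prodAssoc X Y _).sum_comp, Fintype.sum_prod_type_right]
    rfl
  have hAP : ∀ w, IsPMF (A w) := by
    intro w
    by_cases h : p w = 0
    · simpa [hA, h] using hA₀
    · simp only [hA, h, if_false]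
      refine ⟨fun x => div_nonneg (Finset.sum_nonneg fun _ _ => hP.1 _) (hp0 w), ?_⟩
      rw [← Finset.sum_div, hpX, div_self h]
  have hBP : ∀ w, IsPMF (B w) := by
    intro w
    by_cases h : p w = 0
    · simpa [hB, h] using hB₀
    · simp only [hB, h, if_false]
      refine ⟨fun x => div_nonneg (Finset.sum_nonneg fun _ _ => hP.1 _) (hp0 w), ?_⟩
      rw [← Finset.sum_div, hpY, div_self h]
  have hmix : ∀ z, ∑ w, p w * prodPMF (A w) (B w) z = π z := by
    rintro ⟨x, y⟩
    rw [← hPπ x y, hP']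
    rfl
  refine ⟨p, A, B, hpP, hAP, hBP, hmix, ?_⟩
  conv_lhs => rw [hP']
  rw [mutualInfoW_mixture hpP hAP hBP]
  simp only [hmix]

/-- The entropy of a mixture dominates the average entropy of its components. -/
lemma sum_mul_entropy_le {α ι : Type*} [Fintype α] [Fintype ι] {p : ι → ℝ} {q : ι → α → ℝ}
    (hp : IsPMF p) (hq : ∀ i, IsPMF (q i)) :
    ∑ i, p i * entropy (q i) ≤ ∑ a, negMulLog (∑ i, p i * q i a) := by
  simp only [(hq _).entropy_eq, Finset.mul_sum]
  rw [Finset.sum_comm]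
  refine Finset.sum_le_sum fun a _ => ?_
  have := Real.concaveOn_negMulLog.le_map_sum (t := Finset.univ) (w := p) (p := fun i => q i a)
    (fun i _ => hp.1 i) hp.2 fun i _ => (hq i).1 a
  simpa using this

lemma nonneg_of_mem_wynerSet {X Y : Type*} [Fintype X] [Fintype Y] {π : X × Y → ℝ}
    {r : ℝ} (hr : r ∈ wynerSet π) : 0 ≤ r := by
  obtain ⟨p, A, B, hp, hA, hB, h, rfl⟩ := exists_mixture_of_mem_wynerSet hr
  have := sum_mul_entropy_le hp fun w => (hA w).prod (hB w)
  simp only [h] at this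
  linarith

/-- Any finite representation of `π` as a mixture of product distributions is dominated by one
with at most `|X||Y|` components. -/
lemma exists_mem_wynerSet_le {X Y ι : Type*} [Fintype X] [Fintype Y] [Fintype ι]
    {π : X × Y → ℝ} {p : ι → ℝ} {A : ι → X → ℝ} {B : ι → Y → ℝ} (hp : IsPMF p)
    (hA : ∀ w, IsPMF (A w)) (hB : ∀ w, IsPMF (B w))
    (h : ∀ z, ∑ w, p w * prodPMF (A w) (B w) z = π z) :
    ∃ r ∈ wynerSet π,
      r ≤ ∑ z, negMulLog (π z) - ∑ w, p w * entropy (prodPMF (A w) (B w)) := by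
  have hfin : Module.finrank ℝ (X × Y → ℝ) = Fintype.card X * Fintype.card Y := by simp
  have key := exists_fin_finrank (E := X × Y → ℝ)
    (T := {t : (X → ℝ) × (Y → ℝ) // IsPMF t.1 ∧ IsPMF t.2})
    (∑ z, LinearMap.proj z) (fun t => prodPMF t.1.1 t.1.2)
    (fun t => entropy (prodPMF t.1.1 t.1.2)) (fun t => by simpa using (t.2.1.prod t.2.2).2)
    (fun i => ⟨(A i, B i), hA i, hB i⟩) p hp.1 hp.2
  rw [hfin] at key
  obtain ⟨t', w', h1, h2, h3, h4⟩ := key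
  refine ⟨_, mixture_mem_wynerSet w' (fun i => (t' i).1.1) (fun i => (t' i).1.2) ⟨h1, h2⟩
    (fun i => (t' i).2.1) (fun i => (t' i).2.2) ?_, by linarith⟩
  intro z
  have := congrFun h3 z
  simp only [Finset.sum_apply, Pi.smul_apply, smul_eq_mul] at this
  rw [this, h]

lemma wynerSet_nonempty {X Y : Type*} [Fintype X] [Fintype Y] {π : X × Y → ℝ} (hπ : IsPMF π) :
    (wynerSet π).Nonempty := by
  classical
  obtain ⟨r, hr, -⟩ := exists_mem_wynerSet_le (ι := X × Y) hπ (A := fun z => Pi.single z.1 1)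
    (B := fun z => Pi.single z.2 1) (fun z => isPMF_single z.1) (fun z => isPMF_single z.2)
    (π := π) (by
      rintro ⟨x, y⟩
      simp [prodPMF, Fintype.sum_prod_type, Pi.single_apply])
  exact ⟨r, hr⟩

/-- Prepending a letter to a word, as an equivalence. -/
def prependEquiv (X : Type*) (n : ℕ) : (Fin n → X) × X ≃ (Fin (n + 1) → X) :=
  (Equiv.prodComm _ _).trans (Fin.consEquiv fun _ => X)

lemma prependEquiv_apply {X : Type*} {n : ℕ} (x : Fin n → X) (a : X) :
    prependEquiv X n (x, a) = Fin.cons a x := rfl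

section InfoRegion

variable {X Y : Type*} [Fintype X] [Fintype Y]

/-- A measure on `X × Y` together with its entropy and its mutual information. -/
def infoPoint (q : X × Y → ℝ) : (X × Y → ℝ) × ℝ × ℝ := (q, entropy q, mutualInfo q)

variable (X Y) in
/-- The triples (average law, conditional entropy, conditional mutual information) achievable
with a finite time-sharing variable. -/
def infoRegion : Set ((X × Y → ℝ) × ℝ × ℝ) :=
  convexHull ℝ (infoPoint '' stdSimplex ℝ (X × Y))

variable (X Y) in
/-- The cone over `infoRegion`. -/
def infoCone : Set ((X × Y → ℝ) × ℝ × ℝ) :=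
  { v | ∃ t : ℝ, 0 ≤ t ∧ ∃ k ∈ infoRegion X Y, v = t • k }

variable (X Y) in
/-- The total mass of the first component. -/
def massFunctional : (X × Y → ℝ) × ℝ × ℝ →ₗ[ℝ] ℝ :=
  (∑ z, LinearMap.proj z) ∘ₗ LinearMap.fst ℝ (X × Y → ℝ) (ℝ × ℝ)

lemma massFunctional_apply (v : (X × Y → ℝ) × ℝ × ℝ) : massFunctional X Y v = ∑ z, v.1 z := by
  simp [massFunctional]

lemma isCompact_infoRegion : IsCompact (infoRegion X Y) := by
  refine isCompact_convexHull_of_hyperplane (massFunctional X Y)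
    ((isCompact_stdSimplex ℝ _).image ?_) ?_
  · have h1 : Continuous (entropy : (X × Y → ℝ) → ℝ) := continuous_entropy
    have h2 : Continuous (mutualInfo : (X × Y → ℝ) → ℝ) := continuous_mutualInfo
    exact continuous_id.prodMk (h1.prodMk h2)
  · rintro _ ⟨q, hq, rfl⟩
    rw [massFunctional_apply]
    exact hq.2

lemma mass_of_mem_infoRegion {v : (X × Y → ℝ) × ℝ × ℝ} (hv : v ∈ infoRegion X Y) :
    ∑ z, v.1 z = 1 := by
  obtain ⟨ι, _, w, u, hw, hw1, hu, rfl⟩ := mem_convexHull_iff_exists_fintype.1 hv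
  rw [← massFunctional_apply, map_sum]
  simp only [map_smul, massFunctional_apply, smul_eq_mul]
  rw [← hw1]
  refine Finset.sum_congr rfl fun i _ => ?_
  obtain ⟨q, hq, hqu⟩ := hu i
  rw [← hqu]
  have : ∑ z, (infoPoint q).1 z = 1 := hq.2
  rw [this, mul_one]

/-- A point of the region is an average of information points. -/
lemma exists_mixture_of_mem_infoRegion {v : (X × Y → ℝ) × ℝ × ℝ} (hv : v ∈ infoRegion X Y) :
    ∃ (ι : Type) (_ : Fintype ι) (w : ι → ℝ) (q : ι → X × Y → ℝ), IsPMF w ∧ (∀ i, IsPMF (q i)) ∧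
      (∀ z, ∑ i, w i * q i z = v.1 z) ∧ ∑ i, w i * entropy (q i) = v.2.1 ∧
      ∑ i, w i * mutualInfo (q i) = v.2.2 := by
  obtain ⟨ι, _, w, u, hw, hw1, hu, rfl⟩ := mem_convexHull_iff_exists_fintype.1 hv
  choose q hq hqu using hu
  refine ⟨ι, inferInstance, w, q, ⟨hw, hw1⟩, hq, ?_, ?_, ?_⟩
  · intro z
    simp [← hqu, Prod.fst_sum, infoPoint]
  · simp [← hqu, Prod.fst_sum, Prod.snd_sum, infoPoint]
  · simp [← hqu, Prod.snd_sum, infoPoint]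

lemma entropy_le_of_mem_infoRegion {v : (X × Y → ℝ) × ℝ × ℝ} (hv : v ∈ infoRegion X Y) :
    v.2.1 ≤ entropy v.1 := by
  have h1 := mass_of_mem_infoRegion hv
  obtain ⟨ι, _, w, q, hw, hq, hz, he, -⟩ := exists_mixture_of_mem_infoRegion hv
  have := sum_mul_entropy_le hw hq
  simp only [hz] at this
  rw [← he, entropy, h1]
  simpa using this

lemma infoRegion_nonempty [Nonempty X] [Nonempty Y] : (infoRegion X Y).Nonempty := by
  obtain ⟨q, hq⟩ := exists_isPMF (X × Y)
  exact ⟨_, subset_convexHull ℝ _ ⟨q, hq, rfl⟩⟩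

lemma zero_mem_infoCone [Nonempty X] [Nonempty Y] : (0 : (X × Y → ℝ) × ℝ × ℝ) ∈ infoCone X Y := by
  obtain ⟨k, hk⟩ := infoRegion_nonempty (X := X) (Y := Y)
  exact ⟨0, le_rfl, k, hk, by simp⟩

lemma add_mem_infoCone {u v : (X × Y → ℝ) × ℝ × ℝ} (hu : u ∈ infoCone X Y)
    (hv : v ∈ infoCone X Y) : u + v ∈ infoCone X Y := by
  obtain ⟨s, hs, k, hk, rfl⟩ := hu
  obtain ⟨t, ht, l, hl, rfl⟩ := hv
  rcases (add_nonneg hs ht).eq_or_lt with h | h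
  · have hs0 : s = 0 := by linarith
    have ht0 : t = 0 := by linarith
    exact ⟨0, le_rfl, k, hk, by simp [hs0, ht0]⟩
  · refine ⟨s + t, h.le, (s / (s + t)) • k + (t / (s + t)) • l,
      (convex_convexHull ℝ _) hk hl (by positivity) (by positivity) (by field_simp), ?_⟩
    rw [smul_add, smul_smul, smul_smul, mul_div_cancel₀ _ h.ne', mul_div_cancel₀ _ h.ne']

lemma sum_mem_infoCone [Nonempty X] [Nonempty Y] {ι : Type*} [Fintype ι]
    {u : ι → (X × Y → ℝ) × ℝ × ℝ}
    (hu : ∀ i, u i ∈ infoCone X Y) : ∑ i, u i ∈ infoCone X Y :=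
  Finset.sum_induction u (· ∈ infoCone X Y) (fun _ _ => add_mem_infoCone) zero_mem_infoCone
    fun i _ => hu i

lemma infoPoint_mem_infoCone [Nonempty X] [Nonempty Y] {q : X × Y → ℝ} (hq : ∀ z, 0 ≤ q z) :
    infoPoint q ∈ infoCone X Y := by
  have hs : 0 ≤ ∑ z, q z := Finset.sum_nonneg fun z _ => hq z
  rcases hs.eq_or_lt with h | h
  · have h0 : q = 0 := funext fun z =>
      (Finset.sum_eq_zero_iff_of_nonneg fun z _ => hq z).1 h.symm z (Finset.mem_univ z)
    convert! zero_mem_infoCone (X := X) (Y := Y)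
    simp [h0, infoPoint, entropy, mutualInfo]
  · refine ⟨_, hs, infoPoint ((∑ z, q z)⁻¹ • q), subset_convexHull ℝ _ ⟨_, ⟨?_, ?_⟩, rfl⟩, ?_⟩
    · exact fun z => mul_nonneg (inv_nonneg.2 hs) (hq z)
    · simp only [Pi.smul_apply, smul_eq_mul, ← Finset.mul_sum]
      exact inv_mul_cancel₀ h.ne'
    · simp only [infoPoint, entropy_smul, mutualInfo_smul, Prod.smul_mk, smul_eq_mul, smul_smul,
        ← mul_assoc, mul_inv_cancel₀ h.ne', one_mul, one_smul]

lemma inv_smul_mem_infoRegion {v : (X × Y → ℝ) × ℝ × ℝ} (hv : v ∈ infoCone X Y) {t : ℝ}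
    (ht : 0 < t) (hvt : ∑ z, v.1 z = t) : t⁻¹ • v ∈ infoRegion X Y := by
  obtain ⟨s, hs, k, hk, rfl⟩ := hv
  have : s = t := by
    have := mass_of_mem_infoRegion hk
    simpa [← Finset.mul_sum, this] using hvt
  rw [this, smul_smul, inv_mul_cancel₀ ht.ne', one_smul]
  exact hk

open Classical in
/-- The sum of the single-letter marginals of a measure on `Xⁿ × Yⁿ`. -/
def marginalSum {n : ℕ} (q : (Fin n → X) × (Fin n → Y) → ℝ) (w : X × Y) : ℝ :=
  ∑ z, q z * ∑ i, if (z.1 i, z.2 i) = w then 1 else 0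

lemma sum_marginalSum_mul {n : ℕ} (q : (Fin n → X) × (Fin n → Y) → ℝ) (f : X × Y → ℝ) :
    ∑ w, marginalSum q w * f w = ∑ z, q z * ∑ i, f (z.1 i, z.2 i) := by
  classical
  simp only [marginalSum, Finset.sum_mul, Finset.mul_sum]
  rw [Finset.sum_comm]
  refine Finset.sum_congr rfl fun z _ => ?_
  rw [Finset.sum_comm]
  refine Finset.sum_congr rfl fun i _ => ?_
  simp

lemma mass_marginalSum {n : ℕ} (q : (Fin n → X) × (Fin n → Y) → ℝ) :
    ∑ w, marginalSum q w = n * ∑ z, q z := by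
  have := sum_marginalSum_mul q fun _ => 1
  simp only [mul_one] at this
  rw [this]
  simp [Finset.mul_sum, mul_comm]

lemma marginalSum_succ {n : ℕ} (q : (Fin (n + 1) → X) × (Fin (n + 1) → Y) → ℝ) :
    marginalSum q = marginalSum (fun z : (Fin n → X) × (Fin n → Y) =>
        ∑ x, ∑ y, q (Fin.cons x z.1, Fin.cons y z.2)) +
      ∑ z : (Fin n → X) × (Fin n → Y),
        fun w : X × Y => q (Fin.cons w.1 z.1, Fin.cons w.2 z.2) := by
  classical
  funext w
  have he := ((prependEquiv X n).prodCongr (prependEquiv Y n)).sum_comp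
    fun z => q z * ∑ i, if (z.1 i, z.2 i) = w then 1 else 0
  simp only [Pi.add_apply, Finset.sum_apply]
  rw [marginalSum, ← he, ← (Equiv.prodProdProdComm _ _ _ _).sum_comp, Fintype.sum_prod_type]
  simp only [marginalSum]
  rw [← Finset.sum_add_distrib]
  refine Finset.sum_congr rfl fun z _ => ?_
  simp only [Equiv.prodProdProdComm_apply, Equiv.prodCongr_apply, Prod.map,
    prependEquiv_apply, Fin.sum_univ_succ, Fin.cons_zero,
    Fin.cons_succ, mul_add, Finset.sum_add_distrib]
  rw [add_comm]
  congr 1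
  · simp only [Fintype.sum_prod_type, Finset.sum_mul]
  · simp

/-- Single-letterization: the information quantities of a measure on `Xⁿ × Yⁿ` split into
single-letter ones. -/
lemma exists_mem_infoCone [Nonempty X] [Nonempty Y] {n : ℕ} :
    ∀ {q : (Fin n → X) × (Fin n → Y) → ℝ}, (∀ z, 0 ≤ q z) →
    ∃ i ≤ mutualInfo q, (marginalSum q, entropy q, i) ∈ infoCone X Y := by
  induction n with
  | zero =>
    intro q hq
    refine ⟨mutualInfo q, le_rfl, ?_⟩
    convert! zero_mem_infoCone (X := X) (Y := Y) using 1
    refine Prod.ext ?_ (Prod.ext ?_ ?_)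
    · funext w
      simp [marginalSum]
    · simp [entropy, Fintype.sum_prod_type]
    · simp [mutualInfo, Fintype.sum_prod_type]
  | succ n ih =>
    intro q hq
    have h1 := mutualInfo_comp_equiv (prependEquiv X n) (prependEquiv Y n) q
    have h2 := mutualInfo_chain
      (q := fun z => q (prependEquiv X n z.1, prependEquiv Y n z.2)) fun z => hq _
    have h3 := entropy_comp_equiv ((Equiv.prodProdProdComm _ _ _ _).trans
      ((prependEquiv X n).prodCongr (prependEquiv Y n))) q
    rw [entropy_chain] at h3
    simp only [Equiv.trans_apply, Equiv.prodProdProdComm_apply, Equiv.prodCongr_apply, Prod.map,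
      prependEquiv_apply, Fintype.sum_prod_type (α₁ := X)] at h1 h2 h3
    obtain ⟨i, hi, hmem⟩ := ih (q := fun z : (Fin n → X) × (Fin n → Y) =>
        ∑ x, ∑ y, q (Fin.cons x z.1, Fin.cons y z.2))
        fun z => Finset.sum_nonneg fun _ _ => Finset.sum_nonneg fun _ _ => hq _
    have hsum := sum_mem_infoCone fun z : (Fin n → X) × (Fin n → Y) =>
      infoPoint_mem_infoCone (q := fun w : X × Y => q (Fin.cons w.1 z.1, Fin.cons w.2 z.2))
        fun w => hq _
    have := add_mem_infoCone hmem hsum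
    refine ⟨i + ∑ z : (Fin n → X) × (Fin n → Y), mutualInfo fun w : X × Y =>
        q (Fin.cons w.1 z.1, Fin.cons w.2 z.2), ?_, ?_⟩
    · rw [← h1]
      exact le_trans (add_le_add_left hi _) h2
    · convert! this using 1
      refine Prod.ext ?_ (Prod.ext ?_ ?_)
      · simp only [Prod.fst_add, Prod.fst_sum, infoPoint]
        exact marginalSum_succ q
      · simp only [Prod.fst_add, Prod.snd_add, Prod.snd_sum, Prod.fst_sum, infoPoint]
        rw [← h3]
      · simp only [Prod.snd_add, Prod.snd_sum, infoPoint]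

end InfoRegion

lemma mutualInfo_le_of_density_le {α β : Type*} [Fintype α] [Fintype β] {A : α → ℝ} {B : β → ℝ}
    (hA : IsPMF A) (hB : IsPMF B) {q : α × β → ℝ} (hq : ∀ z, 0 ≤ q z) {G : ℝ}
    (hG : ∀ z, q z ≤ G * prodPMF A B z) :
    mutualInfo q ≤ (∑ z, q z) * Real.log G + negMulLog (∑ z, q z) := by
  set s := ∑ z, q z with hs
  have hs0 : 0 ≤ s := Finset.sum_nonneg fun z _ => hq z
  have hqs : ∀ z, q z ≤ s := fun z => Finset.single_le_sum (f := q) (fun _ _ => hq _)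
    (Finset.mem_univ z)
  have hzA : ∀ a b, A a = 0 → q (a, b) = 0 := fun a b h =>
    le_antisymm (by simpa [prodPMF, h] using hG (a, b)) (hq _)
  have hzB : ∀ a b, B b = 0 → q (a, b) = 0 := fun a b h =>
    le_antisymm (by simpa [prodPMF, h] using hG (a, b)) (hq _)
  have hzs : ∀ z, s = 0 → q z = 0 := fun z h => le_antisymm (h ▸ hqs z) (hq z)
  have h1 := sum_negMulLog_le (q := fun a => ∑ b, q (a, b)) (t := fun a => s * A a)
    (fun a => Finset.sum_nonneg fun _ _ => hq _) (fun a => mul_nonneg hs0 (hA.1 a))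
    (fun a h => Finset.sum_eq_zero fun b _ =>
      (mul_eq_zero.1 h).elim (hzs _) (hzA a b))
    (by rw [← Finset.mul_sum, hA.2, mul_one, hs, Fintype.sum_prod_type])
  have h2 := sum_negMulLog_le (q := fun b => ∑ a, q (a, b)) (t := fun b => s * B b)
    (fun a => Finset.sum_nonneg fun _ _ => hq _) (fun a => mul_nonneg hs0 (hB.1 a))
    (fun b h => Finset.sum_eq_zero fun a _ =>
      (mul_eq_zero.1 h).elim (hzs _) (hzB a b))
    (by rw [← Finset.mul_sum, hB.2, mul_one, hs, Fintype.sum_prod_type_right])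
  have h3 : ∑ z : α × β, (q z * Real.log (q z) - q z * Real.log (s * A z.1)
      - q z * Real.log (s * B z.2)) ≤ ∑ z, (q z * Real.log G - 2 * (q z * Real.log s)) := by
    refine Finset.sum_le_sum fun z _ => ?_
    rcases (hq z).eq_or_lt with h | h
    · simp [← h]
    have hAz : 0 < A z.1 := lt_of_le_of_ne (hA.1 _) fun h0 => h.ne' (hzA z.1 z.2 h0.symm)
    have hBz : 0 < B z.2 := lt_of_le_of_ne (hB.1 _) fun h0 => h.ne' (hzB z.1 z.2 h0.symm)
    have hsz : 0 < s := h.trans_le (hqs z)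
    have hGz : 0 < G := by
      by_contra hcon
      have : G * prodPMF A B z ≤ 0 :=
        mul_nonpos_of_nonpos_of_nonneg (not_lt.1 hcon) ((hA.prod hB).1 z)
      linarith [hG z]
    have hl := Real.log_le_log h (hG z)
    rw [prodPMF, Real.log_mul hGz.ne' (mul_pos hAz hBz).ne', Real.log_mul hAz.ne' hBz.ne'] at hl
    rw [Real.log_mul hsz.ne' hAz.ne', Real.log_mul hsz.ne' hBz.ne']
    nlinarith [mul_le_mul_of_nonneg_left hl h.le]
  have e1 : ∑ z : α × β, q z * Real.log (s * A z.1) =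
      ∑ a, (∑ b, q (a, b)) * Real.log (s * A a) := by
    simp [Fintype.sum_prod_type, ← Finset.sum_mul]
  have e2 : ∑ z : α × β, q z * Real.log (s * B z.2) =
      ∑ b, (∑ a, q (a, b)) * Real.log (s * B b) := by
    simp [Fintype.sum_prod_type_right, ← Finset.sum_mul]
  simp only [Finset.sum_sub_distrib, ← Finset.mul_sum, ← Finset.sum_mul] at h3
  rw [e1, e2, ← hs] at h3
  rw [mutualInfo, ← hs]
  have e3 : ∑ z, negMulLog (q z) = - ∑ z, q z * Real.log (q z) := by simp [negMulLog]
  rw [e3]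
  simp only [negMulLog] at h1 h2 ⊢
  linarith

lemma tvDist_eq_one_sub {α : Type*} [Fintype α] {P Q : α → ℝ} (hP : IsPMF P) (hQ : IsPMF Q) :
    ∑ a, min (P a) (Q a) = 1 - tvDist P Q := by
  have h : ∀ a, min (P a) (Q a) = (P a + Q a - |P a - Q a|) / 2 := fun a => by
    rcases le_total (P a) (Q a) with h | h
    · rw [min_eq_left h, abs_of_nonpos (sub_nonpos.2 h)]
      ring
    · rw [min_eq_right h, abs_of_nonneg (sub_nonneg.2 h)]
      ring
  simp only [h, ← Finset.sum_div, Finset.sum_sub_distrib, Finset.sum_add_distrib, hP.2, hQ.2,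
    tvDist]
  ring

lemma tvDist_nonneg {α : Type*} [Fintype α] (P Q : α → ℝ) : 0 ≤ tvDist P Q :=
  div_nonneg (Finset.sum_nonneg fun _ _ => abs_nonneg _) (by norm_num)

lemma tvDist_le_one {α : Type*} [Fintype α] {P Q : α → ℝ} (hP : IsPMF P) (hQ : IsPMF Q) :
    tvDist P Q ≤ 1 := by
  have := tvDist_eq_one_sub hP hQ
  have h : 0 ≤ ∑ a, min (P a) (Q a) := Finset.sum_nonneg fun a _ => le_min (hP.1 a) (hQ.1 a)
  linarith

lemma isPMF_induced {X Y : Type*} [Fintype X] [Fintype Y] {M n : ℕ} (hM : M ≠ 0)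
    (c : SynthCode X Y M n) : IsPMF c.induced := by
  refine ⟨fun z => mul_nonneg (by positivity) (Finset.sum_nonneg fun m _ =>
    mul_nonneg ((c.PX_pmf m).1 _) ((c.PY_pmf m).1 _)), ?_⟩
  have h : ∀ m, ∑ z : (Fin n → X) × (Fin n → Y), c.PX m z.1 * c.PY m z.2 = 1 := fun m =>
    ((c.PX_pmf m).prod (c.PY_pmf m)).2
  simp only [SynthCode.induced, ← Finset.mul_sum]
  rw [Finset.sum_comm]
  simp only [h]
  simp [hM]

lemma sum_pairs_prod {X Y : Type*} [Fintype X] [Fintype Y] {n : ℕ} (f : Fin n → X × Y → ℝ) :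
    ∑ z : (Fin n → X) × (Fin n → Y), ∏ i, f i (z.1 i, z.2 i) = ∏ i, ∑ w, f i w := by
  classical
  simp only [Fintype.sum_prod_type]
  rw [Fintype.prod_sum]
  refine Finset.sum_congr rfl fun x _ => ?_
  rw [Fintype.prod_sum]

lemma isPMF_prodDist {X Y : Type*} [Fintype X] [Fintype Y] {π : X × Y → ℝ} (hπ : IsPMF π)
    (n : ℕ) : IsPMF (prodDist π n) := by
  refine ⟨fun z => Finset.prod_nonneg fun i _ => hπ.1 _, ?_⟩
  simp only [prodDist]
  rw [sum_pairs_prod fun _ => π]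
  simp [hπ.2]

/-- A distribution overlapping with a mixture of `M` product distributions can be bent into a
mixture of `M` nearly product measures dominated by the given distribution. -/
lemma exists_tilted_mixture {X Y : Type*} [Fintype X] [Fintype Y] {M n : ℕ} (hM : M ≠ 0)
    (c : SynthCode X Y M n) {ρ : (Fin n → X) × (Fin n → Y) → ℝ} (hρ : IsPMF ρ) {δ : ℝ}
    (hδ : 0 < δ) (h : tvDist c.induced ρ ≤ 1 - δ) :
    ∃ μ : Fin M → (Fin n → X) × (Fin n → Y) → ℝ, (∀ m z, 0 ≤ μ m z) ∧
      ∑ z, ∑ m, μ m z = 1 ∧ (∀ z, ∑ m, μ m z ≤ ρ z / δ) ∧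
      ∑ m, mutualInfo (μ m) ≤ - Real.log δ ∧
      ∑ z, negMulLog (∑ m, μ m z) - ∑ m, entropy (μ m) ≤ Real.log M := by
  have hQ := isPMF_induced hM c
  have hM' : (0 : ℝ) < M := by positivity
  set T := ∑ z, min (c.induced z) (ρ z) with hT
  have hTδ : δ ≤ T := by
    have := tvDist_eq_one_sub hQ hρ
    linarith
  have hT0 : 0 < T := hδ.trans_le hTδ
  have hpq : ∀ m z, 0 ≤ prodPMF (c.PX m) (c.PY m) z := fun m =>
    ((c.PX_pmf m).prod (c.PY_pmf m)).1
  set g : (Fin n → X) × (Fin n → Y) → ℝ :=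
    fun z => min (c.induced z) (ρ z) / c.induced z / T with hg
  have hmin0 : ∀ z, 0 ≤ min (c.induced z) (ρ z) := fun z => le_min (hQ.1 z) (hρ.1 z)
  have hg0 : ∀ z, 0 ≤ g z := fun z => div_nonneg (div_nonneg (hmin0 z) (hQ.1 z)) hT0.le
  have hg1 : ∀ z, g z ≤ 1 / δ := fun z =>
    div_le_div₀ zero_le_one (div_le_one_of_le₀ (min_le_left _ _) (hQ.1 z)) hδ hTδ
  set μ : Fin M → (Fin n → X) × (Fin n → Y) → ℝ :=
    fun m z => prodPMF (c.PX m) (c.PY m) z * g z / M with hμ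
  have hμ0 : ∀ m z, 0 ≤ μ m z := fun m z =>
    div_nonneg (mul_nonneg (hpq m z) (hg0 z)) hM'.le
  have hν : ∀ z, ∑ m, μ m z = min (c.induced z) (ρ z) / T := by
    intro z
    have h1 : ∑ m, μ m z = c.induced z * g z := by
      simp only [hμ, SynthCode.induced, ← Finset.sum_div, ← Finset.sum_mul]
      simp only [prodPMF]
      ring
    rw [h1, hg]
    rcases (hQ.1 z).eq_or_lt with h0 | h0
    · simp [← h0, hρ.1 z]
    · field_simp
  have hν1 : ∑ z, ∑ m, μ m z = 1 := by
    simp only [hν, ← Finset.sum_div]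
    rw [← hT, div_self hT0.ne']
  have hp1 : ∑ m, ∑ z, μ m z = 1 := by rw [Finset.sum_comm, hν1]
  have hp0 : ∀ m, 0 ≤ ∑ z, μ m z := fun m => Finset.sum_nonneg fun z _ => hμ0 m z
  have hcount : ∑ m, negMulLog (∑ z, μ m z) ≤ Real.log M := by
    have := sum_negMulLog_le (q := fun m => ∑ z, μ m z) (t := fun _ => (M : ℝ)⁻¹) hp0
      (fun _ => by positivity) (fun _ h0 => absurd h0 (by positivity)) (by
        rw [hp1]; simp [hM])
    rw [← Finset.sum_mul, hp1, Real.log_inv] at this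
    linarith
  refine ⟨μ, hμ0, hν1, fun z => ?_, ?_, ?_⟩
  · rw [hν]
    exact div_le_div₀ (hρ.1 z) (min_le_right _ _) hδ hTδ
  · have h1 : ∀ m, mutualInfo (μ m) ≤
        (∑ z, μ m z) * Real.log (1 / δ / M) + negMulLog (∑ z, μ m z) := by
      intro m
      refine mutualInfo_le_of_density_le (c.PX_pmf m) (c.PY_pmf m) (hμ0 m) fun z => ?_
      simp only [hμ]
      rw [div_mul_eq_mul_div, mul_comm]
      exact div_le_div_of_nonneg_right (mul_le_mul_of_nonneg_right (hg1 z) (hpq m z)) hM'.le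
    have h2 := Finset.sum_le_sum fun m (_ : m ∈ Finset.univ) => h1 m
    rw [Finset.sum_add_distrib, ← Finset.sum_mul, hp1, Real.log_div (by positivity) hM'.ne',
      one_div, Real.log_inv] at h2
    linarith
  · have h1 : ∑ z, negMulLog (∑ m, μ m z) ≤ ∑ m, ∑ z, negMulLog (μ m z) := by
      rw [Finset.sum_comm]
      refine Finset.sum_le_sum fun z _ => ?_
      have : negMulLog (∑ m, μ m z) = ∑ m, -(μ m z * Real.log (∑ m, μ m z)) := by
        rw [Finset.sum_neg_distrib, ← Finset.sum_mul, negMulLog, neg_mul]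
      rw [this]
      refine Finset.sum_le_sum fun m _ => ?_
      rw [negMulLog, neg_mul, neg_le_neg_iff]
      rcases (hμ0 m z).eq_or_lt with h0 | h0
      · simp [← h0]
      · exact mul_le_mul_of_nonneg_left (Real.log_le_log h0
          (Finset.single_le_sum (f := fun m => μ m z) (fun m _ => hμ0 m z)
            (Finset.mem_univ m))) h0.le
    simp only [entropy, Finset.sum_sub_distrib]
    linarith

/-- A good code yields a nearly feasible single-letter point. -/
lemma exists_mem_infoRegion_of_code {X Y : Type*} [Fintype X] [Fintype Y] {π : X × Y → ℝ}
    (hπ : IsPMF π) {M n : ℕ} (hM : M ≠ 0) (hn : n ≠ 0) (c : SynthCode X Y M n) {δ : ℝ}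
    (hδ : 0 < δ) (h : tvDist c.induced (prodDist π n) ≤ 1 - δ) :
    ∃ v ∈ infoRegion X Y, v.2.2 ≤ - Real.log δ / n ∧
      (Real.log δ - Real.log M) / n - ∑ w, v.1 w * Real.log (π w) ≤ v.2.1 ∧
      Real.log δ / n - ∑ w, v.1 w * Real.log (π w) ≤ entropy v.1 ∧
      ∀ w, π w = 0 → v.1 w = 0 := by
  have : Nonempty X := hπ.nonempty.map Prod.fst
  have : Nonempty Y := hπ.nonempty.map Prod.snd
  have hn' : (0 : ℝ) < n := by positivity
  have hprod := isPMF_prodDist hπ n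
  obtain ⟨μ, hμ0, hμ1, hμρ, hμI, hμH⟩ := exists_tilted_mixture hM c hprod hδ h
  set ν : (Fin n → X) × (Fin n → Y) → ℝ := fun z => ∑ m, μ m z with hν
  have hν0 : ∀ z, 0 ≤ ν z := fun z => Finset.sum_nonneg fun m _ => hμ0 m z
  have hνπ : ∀ z, 0 < ν z → ∀ i, 0 < π (z.1 i, z.2 i) := by
    intro z hz i
    refine lt_of_le_of_ne (hπ.1 _) fun h0 => ?_
    have h1 : prodDist π n z = 0 := Finset.prod_eq_zero (Finset.mem_univ i) h0.symm
    have := hμρ z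
    rw [h1, zero_div] at this
    exact absurd hz (not_lt.2 this)
  have hmarg : marginalSum ν = ∑ m, marginalSum (μ m) := by
    funext w
    simp only [marginalSum, hν, Finset.sum_apply, Finset.sum_mul]
    exact Finset.sum_comm
  have hmass : ∑ w, marginalSum ν w = n := by
    rw [mass_marginalSum, hμ1, mul_one]
  have hent : entropy ν = ∑ z, negMulLog (ν z) := by
    have h1 : ∑ z, ν z = 1 := hμ1
    rw [entropy, h1]
    simp
  have hlow : Real.log δ - ∑ w, marginalSum ν w * Real.log (π w) ≤ entropy ν := by
    rw [sum_marginalSum_mul, hent]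
    have h1 : Real.log δ = ∑ z, ν z * Real.log δ := by rw [← Finset.sum_mul, hμ1, one_mul]
    rw [h1, ← Finset.sum_sub_distrib]
    refine Finset.sum_le_sum fun z _ => ?_
    rcases (hν0 z).eq_or_lt with h0 | h0
    · simp [← h0]
    have hl := Real.log_le_log h0 (hμρ z)
    have hpz : 0 < prodDist π n z := Finset.prod_pos fun i _ => hνπ z h0 i
    rw [Real.log_div hpz.ne' hδ.ne', prodDist, Real.log_prod fun i _ => (hνπ z h0 i).ne'] at hl
    rw [negMulLog]
    nlinarith [mul_le_mul_of_nonneg_left hl h0.le]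
  choose i hi hmem using fun m => exists_mem_infoCone (hμ0 m)
  have hv := sum_mem_infoCone hmem
  have hv1 : ∑ m, (marginalSum (μ m), entropy (μ m), i m) =
      (marginalSum ν, ∑ m, entropy (μ m), ∑ m, i m) := by
    rw [hmarg]
    exact Prod.ext (by simp [Prod.fst_sum])
      (Prod.ext (by simp [Prod.fst_sum, Prod.snd_sum]) (by simp [Prod.snd_sum]))
  rw [hv1] at hv
  have hv' := inv_smul_mem_infoRegion hv hn' hmass
  obtain ⟨j, -, hj⟩ := exists_mem_infoCone hν0
  have hj' := entropy_le_of_mem_infoRegion (inv_smul_mem_infoRegion hj hn' hmass)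
  simp only [Prod.smul_mk, smul_eq_mul] at hv' hj'
  have hsum : ∑ w, ((n : ℝ)⁻¹ • marginalSum ν) w * Real.log (π w) =
      (∑ w, marginalSum ν w * Real.log (π w)) / n := by
    simp only [Pi.smul_apply, smul_eq_mul, mul_assoc, ← Finset.mul_sum]
    rw [inv_mul_eq_div]
  refine ⟨_, hv', ?_, ?_, ?_, ?_⟩
  · simp only
    rw [inv_mul_eq_div]
    exact div_le_div_of_nonneg_right ((Finset.sum_le_sum fun m _ => hi m).trans hμI) hn'.le
  · simp only
    rw [hsum, ← sub_div, inv_mul_eq_div]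
    refine div_le_div_of_nonneg_right ?_ hn'.le
    linarith
  · simp only
    rw [hsum, ← sub_div]
    refine le_trans ?_ hj'
    rw [inv_mul_eq_div]
    exact div_le_div_of_nonneg_right hlow hn'.le
  · intro w hw
    simp only [Pi.smul_apply, smul_eq_mul, marginalSum]
    refine mul_eq_zero_of_right _ (Finset.sum_eq_zero fun z _ => ?_)
    rcases (hν0 z).eq_or_lt with h0 | h0
    · simp [← h0]
    refine mul_eq_zero_of_right _ (Finset.sum_eq_zero fun k _ => ?_)
    rw [if_neg]
    rintro rfl
    exact (hνπ z h0 k).ne' hw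

lemma numMsgs_ne_zero (R : ℝ) (n : ℕ) : numMsgs R n ≠ 0 :=
  (Nat.ceil_pos.2 (Real.exp_pos _)).ne'

lemma log_numMsgs_le {R : ℝ} (hR : 0 ≤ R) (n : ℕ) :
    Real.log (numMsgs R n) ≤ n * R + Real.log 2 := by
  have h1 : 1 ≤ Real.exp (n * R) := Real.one_le_exp (by positivity)
  have h2 : (numMsgs R n : ℝ) ≤ 2 * Real.exp (n * R) := by
    have := (Nat.ceil_lt_add_one (Real.exp_pos (n * R)).le).le
    rw [numMsgs]
    linarith
  have h3 : (0 : ℝ) < numMsgs R n := by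
    have := numMsgs_ne_zero R n
    positivity
  refine (Real.log_le_log h3 h2).trans ?_
  rw [Real.log_mul (by norm_num) (Real.exp_pos _).ne', Real.log_exp]
  linarith

lemma tvDist_code_le_one {X Y : Type*} [Fintype X] [Fintype Y] {π : X × Y → ℝ} (hπ : IsPMF π)
    {R : ℝ} {n : ℕ} (c : SynthCode X Y (numMsgs R n) n) :
    tvDist c.induced (prodDist π n) ≤ 1 :=
  tvDist_le_one (isPMF_induced (numMsgs_ne_zero R n) c) (isPMF_prodDist hπ n)

/-- The strong converse. -/
lemma exists_mem_wynerSet_le_rate {X Y : Type*} [Fintype X] [Fintype Y] {π : X × Y → ℝ}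
    (hπ : IsPMF π) {ε R : ℝ} (hε : ε < 1) (hR : 0 ≤ R)
    (c : (n : ℕ) → SynthCode X Y (numMsgs R n) n)
    (hc : limsup (fun n => tvDist ((c n).induced) (prodDist π n)) atTop ≤ ε) :
    ∃ r ∈ wynerSet π, r ≤ R := by
  obtain ⟨ε', hεε', hε'⟩ := exists_between hε
  set δ := 1 - ε' with hδ
  have hδ0 : 0 < δ := by linarith
  have hev : ∀ᶠ n in atTop, tvDist ((c n).induced) (prodDist π n) < ε' :=
    eventually_lt_of_limsup_lt (hc.trans_lt hεε')
      (isBoundedUnder_of ⟨1, fun n => tvDist_code_le_one hπ (c n)⟩)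
  obtain ⟨N, hN⟩ := eventually_atTop.1 hev
  have hex : ∀ n : ℕ, ∃ v ∈ infoRegion X Y, v.2.2 ≤ - Real.log δ / ((n + N + 1 : ℕ) : ℝ) ∧
      (Real.log δ - Real.log 2) / ((n + N + 1 : ℕ) : ℝ) - R - ∑ w, v.1 w * Real.log (π w) ≤ v.2.1 ∧
      Real.log δ / ((n + N + 1 : ℕ) : ℝ) - ∑ w, v.1 w * Real.log (π w) ≤ entropy v.1 ∧
      ∀ w, π w = 0 → v.1 w = 0 := by
    intro n
    obtain ⟨v, hv, h1, h2, h3, h4⟩ := exists_mem_infoRegion_of_code hπ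
      (numMsgs_ne_zero R (n + N + 1)) (Nat.succ_ne_zero _) (c (n + N + 1)) hδ0
      (by have := hN (n + N + 1) (by omega); linarith)
    refine ⟨v, hv, h1, le_trans ?_ h2, h3, h4⟩
    have hpos : (0 : ℝ) < ((n + N + 1 : ℕ) : ℝ) := by positivity
    have h5 := log_numMsgs_le hR (n + N + 1)
    have h6 : (Real.log δ - Real.log 2) / ((n + N + 1 : ℕ) : ℝ) - R ≤
        (Real.log δ - Real.log (numMsgs R (n + N + 1))) / ((n + N + 1 : ℕ) : ℝ) := by
      rw [div_sub' hpos.ne']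
      refine div_le_div_of_nonneg_right ?_ hpos.le
      linarith
    linarith
  choose v hv h1 h2 h3 h4 using hex
  obtain ⟨u, hu, φ, hφ, hlim⟩ := isCompact_infoRegion.tendsto_subseq hv
  have hφ' : Tendsto (fun k => ((φ k + N + 1 : ℕ) : ℝ)) atTop atTop :=
    tendsto_natCast_atTop_atTop.comp (tendsto_atTop_mono (fun k => by omega) hφ.tendsto_atTop)
  have hdiv : ∀ a : ℝ, Tendsto (fun k => a / ((φ k + N + 1 : ℕ) : ℝ)) atTop (nhds 0) := fun a =>
    hφ'.const_div_atTop a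
  have hl1 : Tendsto (fun k => (v (φ k)).1) atTop (nhds u.1) :=
    (continuous_fst.tendsto u).comp hlim
  have hl2 : Tendsto (fun k => (v (φ k)).2.1) atTop (nhds u.2.1) :=
    ((continuous_fst.comp continuous_snd).tendsto u).comp hlim
  have hl3 : Tendsto (fun k => (v (φ k)).2.2) atTop (nhds u.2.2) :=
    ((continuous_snd.comp continuous_snd).tendsto u).comp hlim
  have hlw : ∀ w, Tendsto (fun k => (v (φ k)).1 w) atTop (nhds (u.1 w)) := fun w =>
    ((continuous_apply w).tendsto _).comp hl1
  have hls : Tendsto (fun k => ∑ w, (v (φ k)).1 w * Real.log (π w)) atTop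
      (nhds (∑ w, u.1 w * Real.log (π w))) :=
    tendsto_finsetSum _ fun w _ => (hlw w).mul_const _
  have hle : Tendsto (fun k => entropy (v (φ k)).1) atTop (nhds (entropy u.1)) :=
    (continuous_entropy.tendsto _).comp hl1
  have g1 : u.2.2 ≤ 0 := le_of_tendsto_of_tendsto' hl3 (hdiv _) fun k => h1 (φ k)
  have g2 : 0 - R - ∑ w, u.1 w * Real.log (π w) ≤ u.2.1 :=
    le_of_tendsto_of_tendsto' (((hdiv _).sub_const R).sub hls) hl2 fun k => h2 (φ k)
  have g3 : 0 - ∑ w, u.1 w * Real.log (π w) ≤ entropy u.1 :=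
    le_of_tendsto_of_tendsto' ((hdiv _).sub hls) hle fun k => h3 (φ k)
  have g4 : ∀ w, π w = 0 → u.1 w = 0 := fun w hw =>
    tendsto_nhds_unique (hlw w) (by simp [fun k => h4 (φ k) w hw])
  have hmass := mass_of_mem_infoRegion hu
  obtain ⟨ι, _, w, q, hw, hq, hz, he, hI⟩ := exists_mixture_of_mem_infoRegion hu
  have hu0 : ∀ z, 0 ≤ u.1 z := fun z => by
    rw [← hz]
    exact Finset.sum_nonneg fun i _ => mul_nonneg (hw.1 i) ((hq i).1 z)
  have huπ : u.1 = π := by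
    refine eq_of_le_sum_negMulLog hu0 hπ.1 g4 (by rw [hmass, hπ.2]) ?_
    rw [IsPMF.entropy_eq ⟨hu0, hmass⟩] at g3
    linarith
  have hI0 : ∀ i, w i * mutualInfo (q i) = 0 := fun i =>
    (Finset.sum_eq_zero_iff_of_nonneg fun i _ =>
      mul_nonneg (hw.1 i) (mutualInfo_nonneg (hq i).1)).1
      (le_antisymm (hI ▸ g1) (Finset.sum_nonneg fun i _ =>
        mul_nonneg (hw.1 i) (mutualInfo_nonneg (hq i).1))) i (Finset.mem_univ i)
  have hqprod : ∀ i, w i ≠ 0 → prodPMF (fun x => ∑ y, q i (x, y)) (fun y => ∑ x, q i (x, y)) =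
      q i := fun i hi => funext fun z => (eq_prod_of_mutualInfo_le (hq i).1 (hq i).2
        ((mul_eq_zero.1 (hI0 i)).resolve_left hi).le z).symm
  obtain ⟨r, hr, hle'⟩ := exists_mem_wynerSet_le (π := π) (A := fun i x => ∑ y, q i (x, y))
    (B := fun i y => ∑ x, q i (x, y)) hw
    (fun i => ⟨fun x => Finset.sum_nonneg fun y _ => (hq i).1 _, by
      rw [← Fintype.sum_prod_type, (hq i).2]⟩)
    (fun i => ⟨fun y => Finset.sum_nonneg fun x _ => (hq i).1 _, by
      rw [← Fintype.sum_prod_type_right, (hq i).2]⟩) (fun z => by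
        rw [← huπ, ← hz z]
        refine Finset.sum_congr rfl fun i _ => ?_
        rcases eq_or_ne (w i) 0 with h0 | h0
        · simp [h0]
        · rw [hqprod i h0])
  refine ⟨r, hr, hle'.trans ?_⟩
  have hsame : ∑ i, w i * entropy (prodPMF (fun x => ∑ y, q i (x, y)) fun y => ∑ x, q i (x, y)) =
      u.2.1 := by
    rw [← he]
    refine Finset.sum_congr rfl fun i _ => ?_
    rcases eq_or_ne (w i) 0 with h0 | h0
    · simp [h0]
    · rw [hqprod i h0]
  rw [hsame]
  rw [huπ] at g2
  have : ∑ z, negMulLog (π z) = - ∑ z, π z * Real.log (π z) := by simp [negMulLog]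
  linarith

lemma sum_pi_mul_prod {V : Type*} [Fintype V] {M : ℕ} (p : V → ℝ) (f : Fin M → V → ℝ) :
    ∑ v : Fin M → V, (∏ m, p (v m)) * ∏ m, f m (v m) = ∏ m, ∑ x, p x * f m x := by
  classical
  rw [Fintype.prod_sum]
  exact Finset.sum_congr rfl fun v _ => Finset.prod_mul_distrib.symm

lemma IsPMF.pi {V : Type*} [Fintype V] {p : V → ℝ} (hp : IsPMF p) (M : ℕ) :
    IsPMF fun v : Fin M → V => ∏ m, p (v m) := by
  refine ⟨fun v => Finset.prod_nonneg fun m _ => hp.1 _, ?_⟩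
  simpa [hp.2] using sum_pi_mul_prod (M := M) p fun _ _ => 1

lemma sum_pi_mul_apply {V : Type*} [Fintype V] {p : V → ℝ} (hp : IsPMF p) {M : ℕ} (g : V → ℝ)
    (i : Fin M) : ∑ v : Fin M → V, (∏ m, p (v m)) * g (v i) = ∑ x, p x * g x := by
  have h := sum_pi_mul_prod (M := M) p fun m x => if m = i then g x else 1
  simpa [apply_ite, Finset.sum_ite_irrel, hp.2] using h

lemma sum_pi_mul_apply_mul_apply {V : Type*} [Fintype V] {p : V → ℝ} {M : ℕ}
    {g : V → ℝ} (hg : ∑ x, p x * g x = 0) {i j : Fin M} (hij : i ≠ j) :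
    ∑ v : Fin M → V, (∏ m, p (v m)) * (g (v i) * g (v j)) = 0 := by
  have h := sum_pi_mul_prod (M := M) p
    fun m x => (if m = i then g x else 1) * (if m = j then g x else 1)
  simp only [Finset.prod_mul_distrib, Finset.prod_ite_eq', Finset.mem_univ, if_true] at h
  rw [h]
  exact Finset.prod_eq_zero (Finset.mem_univ i) (by simpa [hij] using hg)

/-- The second moment of a sum of independent centred variables. -/
lemma sum_pi_mul_sum_sq {V : Type*} [Fintype V] {p : V → ℝ} (hp : IsPMF p) (M : ℕ)
    {g : V → ℝ} (hg : ∑ x, p x * g x = 0) :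
    ∑ v : Fin M → V, (∏ m, p (v m)) * (∑ m, g (v m)) ^ 2 = M * ∑ x, p x * g x ^ 2 := by
  have h : ∀ i j : Fin M, ∑ v : Fin M → V, (∏ m, p (v m)) * (g (v i) * g (v j)) =
      if i = j then ∑ x, p x * g x ^ 2 else 0 := fun i j => by
    split_ifs with hij
    · subst hij
      simpa only [← sq] using sum_pi_mul_apply hp (fun x => g x ^ 2) i
    · exact sum_pi_mul_apply_mul_apply hg hij
  have hsq : ∀ v : Fin M → V, (∏ m, p (v m)) * (∑ m, g (v m)) ^ 2 =
      ∑ i, ∑ j, (∏ m, p (v m)) * (g (v i) * g (v j)) := fun v => by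
    rw [sq, Finset.sum_mul_sum]
    simp only [Finset.mul_sum]
  simp only [hsq]
  rw [Finset.sum_comm]
  simp_rw [Finset.sum_comm (s := (Finset.univ : Finset (Fin M → V))), h]
  simp

lemma IsPMF.exists_le {V : Type*} [Fintype V] {p : V → ℝ} (hp : IsPMF p) {F : V → ℝ} {C : ℝ}
    (h : ∑ v, p v * F v ≤ C) : ∃ v, F v ≤ C := by
  by_contra! hlt
  obtain ⟨w, hw⟩ : ∃ w, 0 < p w := by
    by_contra! h0
    have := Finset.sum_nonpos fun w (_ : w ∈ Finset.univ) => h0 w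
    linarith [hp.2]
  have : ∑ v, p v * C < ∑ v, p v * F v :=
    Finset.sum_lt_sum (fun v _ => mul_le_mul_of_nonneg_left (hlt v).le (hp.1 v))
      ⟨w, Finset.mem_univ w, mul_lt_mul_of_pos_left (hlt w) hw⟩
  rw [← Finset.sum_mul, hp.2] at this
  linarith

/-- The mean deviation of an empirical average of bounded variables. -/
lemma sum_pi_mul_abs_le {V : Type*} [Fintype V] {p : V → ℝ} (hp : IsPMF p) {M : ℕ} (hM : M ≠ 0)
    {f : V → ℝ} (hf : ∀ x, 0 ≤ f x) {τ ρ a : ℝ} (hfτ : ∀ x, f x ≤ τ * ρ) (hρ : 0 ≤ ρ)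
    (hpf : ∑ x, p x * f x ≤ ρ) (hτ : 0 ≤ τ) (ha : 0 < a) :
    ∑ v : Fin M → V, (∏ m, p (v m)) * |(M : ℝ)⁻¹ * ∑ m, f (v m) - ∑ x, p x * f x| ≤
      (τ / (a * M) + a) / 2 * ρ := by
  have hM0 : (0 : ℝ) < M := by positivity
  rcases hρ.eq_or_lt with rfl | hρ
  · have : ∀ x, f x = 0 := fun x => le_antisymm (by simpa using hfτ x) (hf x)
    simp [this]
  set e := ∑ x, p x * f x with he
  have hg : ∑ x, p x * (f x - e) = 0 := by
    simp [mul_sub, Finset.sum_sub_distrib, ← Finset.sum_mul, hp.2, ← he]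
  have hvar : ∑ x, p x * (f x - e) ^ 2 ≤ τ * ρ * ρ := by
    have h1 : ∑ x, p x * (f x - e) ^ 2 = ∑ x, p x * f x ^ 2 - e ^ 2 := by
      have : ∀ x, p x * (f x - e) ^ 2 = p x * f x ^ 2 - 2 * e * (p x * f x) + p x * e ^ 2 :=
        fun x => by ring
      simp only [this, Finset.sum_add_distrib, Finset.sum_sub_distrib, ← Finset.mul_sum,
        ← Finset.sum_mul, hp.2, ← he]
      ring
    have h2 : ∑ x, p x * f x ^ 2 ≤ ∑ x, τ * ρ * (p x * f x) :=
      Finset.sum_le_sum fun x _ => by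
        nlinarith [mul_le_mul_of_nonneg_left (hfτ x) (mul_nonneg (hp.1 x) (hf x))]
    rw [← Finset.mul_sum, ← he] at h2
    nlinarith [mul_le_mul_of_nonneg_left hpf (mul_nonneg hτ hρ.le), sq_nonneg e]
  have hpt : ∀ v : Fin M → V, |(M : ℝ)⁻¹ * ∑ m, f (v m) - e| ≤
      ((∑ m, (f (v m) - e)) ^ 2 / (M ^ 2 * (a * ρ)) + a * ρ) / 2 := fun v => by
    have h1 : (M : ℝ)⁻¹ * ∑ m, f (v m) - e = (∑ m, (f (v m) - e)) / M := by
      simp [Finset.sum_sub_distrib]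
      field_simp
    rw [h1]
    set S := ∑ m, (f (v m) - e)
    have h2 : S ^ 2 / (M ^ 2 * (a * ρ)) = |S / M| ^ 2 / (a * ρ) := by
      rw [sq_abs]
      field_simp
    rw [h2, le_div_iff₀ two_pos, div_add' _ _ _ (by positivity), le_div_iff₀ (by positivity)]
    nlinarith [sq_nonneg (|S / M| - a * ρ)]
  have hP := hp.pi M
  calc ∑ v : Fin M → V, (∏ m, p (v m)) * |(M : ℝ)⁻¹ * ∑ m, f (v m) - e|
      ≤ ∑ v : Fin M → V, (∏ m, p (v m)) *
        (((∑ m, (f (v m) - e)) ^ 2 / (M ^ 2 * (a * ρ)) + a * ρ) / 2) :=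
        Finset.sum_le_sum fun v _ => mul_le_mul_of_nonneg_left (hpt v) (hP.1 v)
    _ = ((∑ v : Fin M → V, (∏ m, p (v m)) * (∑ m, (f (v m) - e)) ^ 2) / (M ^ 2 * (a * ρ)) +
        (∑ v : Fin M → V, ∏ m, p (v m)) * (a * ρ)) / 2 := by
        rw [Finset.sum_mul, Finset.sum_div, ← Finset.sum_add_distrib, Finset.sum_div]
        exact Finset.sum_congr rfl fun v _ => by ring
    _ = ((M * ∑ x, p x * (f x - e) ^ 2) / (M ^ 2 * (a * ρ)) + a * ρ) / 2 := by
        rw [sum_pi_mul_sum_sq hp M hg, hP.2, one_mul]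
    _ ≤ ((M * (τ * ρ * ρ)) / (M ^ 2 * (a * ρ)) + a * ρ) / 2 := by gcongr
    _ = (τ / (a * M) + a) / 2 * ρ := by field_simp

/-- The one-shot soft-covering lemma. -/
lemma exists_codebook {V Z : Type*} [Fintype V] [Fintype Z] {p : V → ℝ} (hp : IsPMF p)
    {K : V → Z → ℝ} (hK : ∀ v, IsPMF (K v)) {M : ℕ} (hM : M ≠ 0) {τ a s : ℝ} (hτ : 0 < τ)
    (ha : 0 < a) (hs : 0 ≤ s) {ρ : Z → ℝ} (hρ : ∀ z, ∑ x, p x * K x z = ρ z) :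
    ∃ v : Fin M → V, ∑ z, |(M : ℝ)⁻¹ * ∑ m, K (v m) z - ρ z| ≤
      2 * (τ ^ (-s) * ∑ x, ∑ z, p x * (K x z * (K x z / ρ z) ^ s)) + (τ / (a * M) + a) / 2 := by
  have hM0 : (0 : ℝ) < M := by positivity
  have hρ0 : ∀ z, 0 ≤ ρ z := fun z => by
    rw [← hρ]
    exact Finset.sum_nonneg fun x _ => mul_nonneg (hp.1 x) ((hK x).1 z)
  have hρ1 : ∑ z, ρ z = 1 := by
    simp only [← hρ]
    rw [Finset.sum_comm]
    simp [← Finset.mul_sum, (hK _).2, hp.2]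
  set f : Z → V → ℝ := fun z x => if K x z ≤ τ * ρ z then K x z else 0 with hf
  set h : Z → V → ℝ := fun z x => K x z - f z x with hh
  have hf0 : ∀ z x, 0 ≤ f z x := fun z x => by
    simp only [hf]
    split_ifs
    exacts [(hK x).1 z, le_rfl]
  have hh0 : ∀ z x, 0 ≤ h z x := fun z x => by
    simp only [hh, hf]
    split_ifs
    exacts [(sub_self _).ge, by simpa using (hK x).1 z]
  have hfτ : ∀ z x, f z x ≤ τ * ρ z := fun z x => by
    simp only [hf]
    split_ifs with hle
    exacts [hle, mul_nonneg hτ.le (hρ0 z)]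
  have hfh : ∀ z, ∑ x, p x * f z x + ∑ x, p x * h z x = ρ z := fun z => by
    rw [← hρ, ← Finset.sum_add_distrib]
    exact Finset.sum_congr rfl fun x _ => by simp only [hh]; ring
  have hph : ∀ z, 0 ≤ ∑ x, p x * h z x := fun z =>
    Finset.sum_nonneg fun x _ => mul_nonneg (hp.1 x) (hh0 z x)
  have htail : ∀ z x, p x * h z x ≤ τ ^ (-s) * (p x * (K x z * (K x z / ρ z) ^ s)) :=
    fun z x => by
    have hnn : 0 ≤ τ ^ (-s) * (p x * (K x z * (K x z / ρ z) ^ s)) :=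
      mul_nonneg (Real.rpow_nonneg hτ.le _) (mul_nonneg (hp.1 x) (mul_nonneg ((hK x).1 z)
        (Real.rpow_nonneg (div_nonneg ((hK x).1 z) (hρ0 z)) _)))
    simp only [hh, hf]
    split_ifs with hle
    · simpa using hnn
    rcases (hρ0 z).eq_or_lt with hz | hz
    · have h0 : p x * K x z = 0 := (Finset.sum_eq_zero_iff_of_nonneg fun x _ =>
        mul_nonneg (hp.1 x) ((hK x).1 z)).1 ((hρ z).trans hz.symm) x (Finset.mem_univ x)
      rw [sub_zero, h0]
      exact hnn
    have h1 : 1 ≤ τ ^ (-s) * (K x z / ρ z) ^ s := by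
      rw [Real.rpow_neg hτ.le, ← Real.inv_rpow hτ.le, ← Real.mul_rpow (inv_nonneg.2 hτ.le)
        (div_nonneg ((hK x).1 z) (hρ0 z))]
      refine Real.one_le_rpow ?_ hs
      rw [inv_mul_eq_div, le_div_iff₀ hτ, le_div_iff₀ hz, one_mul]
      exact (not_le.1 hle).le
    nlinarith [mul_le_mul_of_nonneg_left h1 (mul_nonneg (hp.1 x) ((hK x).1 z))]
  have hP := hp.pi M
  refine hP.exists_le ?_
  have hpt : ∀ z (v : Fin M → V), |(M : ℝ)⁻¹ * ∑ m, K (v m) z - ρ z| ≤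
      |(M : ℝ)⁻¹ * ∑ m, f z (v m) - ∑ x, p x * f z x| + (M : ℝ)⁻¹ * ∑ m, h z (v m) +
        ∑ x, p x * h z x := fun z v => by
    have h1 : (M : ℝ)⁻¹ * ∑ m, K (v m) z - ρ z =
        ((M : ℝ)⁻¹ * ∑ m, f z (v m) - ∑ x, p x * f z x) + (M : ℝ)⁻¹ * ∑ m, h z (v m) -
          ∑ x, p x * h z x := by
      simp only [← hfh z, hh, Finset.sum_sub_distrib]
      ring
    have h2 : 0 ≤ (M : ℝ)⁻¹ * ∑ m, h z (v m) :=
      mul_nonneg (inv_nonneg.2 hM0.le) (Finset.sum_nonneg fun m _ => hh0 z _)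
    rw [h1]
    refine (abs_sub _ _).trans (add_le_add ((abs_add_le _ _).trans ?_) ?_)
    · rw [abs_of_nonneg h2]
    · rw [abs_of_nonneg (hph z)]
  have hz : ∀ z, ∑ v : Fin M → V, (∏ m, p (v m)) * |(M : ℝ)⁻¹ * ∑ m, K (v m) z - ρ z| ≤
      (τ / (a * M) + a) / 2 * ρ z + 2 * ∑ x, p x * h z x := fun z => by
    have h1 := sum_pi_mul_abs_le hp hM (hf0 z) (hfτ z) (hρ0 z)
      (by linarith [hfh z, hph z]) hτ.le ha
    have h2 : ∑ v : Fin M → V, (∏ m, p (v m)) * ((M : ℝ)⁻¹ * ∑ m, h z (v m)) =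
        ∑ x, p x * h z x := by
      have : ∑ v : Fin M → V, (∏ m, p (v m)) * ((M : ℝ)⁻¹ * ∑ m, h z (v m)) =
          (M : ℝ)⁻¹ * ∑ i, ∑ v : Fin M → V, (∏ m, p (v m)) * h z (v i) := by
        rw [Finset.sum_comm, Finset.mul_sum]
        refine Finset.sum_congr rfl fun v _ => ?_
        rw [← Finset.mul_sum]
        ring
      rw [this]
      simp only [sum_pi_mul_apply hp, Finset.sum_const, Finset.card_univ, Fintype.card_fin,
        nsmul_eq_mul]
      field_simp
    calc _ ≤ ∑ v : Fin M → V, (∏ m, p (v m)) *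
          (|(M : ℝ)⁻¹ * ∑ m, f z (v m) - ∑ x, p x * f z x| + (M : ℝ)⁻¹ * ∑ m, h z (v m) +
            ∑ x, p x * h z x) :=
          Finset.sum_le_sum fun v _ => mul_le_mul_of_nonneg_left (hpt z v) (hP.1 v)
      _ ≤ _ := by
          simp only [mul_add, Finset.sum_add_distrib, h2]
          rw [← Finset.sum_mul, hP.2]
          linarith
  have hswap : ∑ v : Fin M → V, (∏ m, p (v m)) * ∑ z, |(M : ℝ)⁻¹ * ∑ m, K (v m) z - ρ z| =
      ∑ z, ∑ v : Fin M → V, (∏ m, p (v m)) * |(M : ℝ)⁻¹ * ∑ m, K (v m) z - ρ z| := by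
    simp only [Finset.mul_sum]
    rw [Finset.sum_comm]
  rw [hswap]
  refine (Finset.sum_le_sum fun z _ => hz z).trans ?_
  rw [Finset.sum_add_distrib, ← Finset.mul_sum, ← Finset.mul_sum, hρ1, mul_one, add_comm]
  gcongr
  rw [Finset.sum_comm, Finset.mul_sum]
  exact Finset.sum_le_sum fun x _ => by
    rw [Finset.mul_sum]
    exact Finset.sum_le_sum fun z _ => htail z x

lemma hasDerivAt_mul_rpow {c r : ℝ} (h : c ≠ 0 → 0 < r) :
    HasDerivAt (fun s : ℝ => c * r ^ s) (c * Real.log r) 0 := by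
  by_cases hc : c = 0
  · simpa [hc] using hasDerivAt_const (0 : ℝ) (0 : ℝ)
  · simpa using (Real.hasStrictDerivAt_const_rpow (h hc) 0).hasDerivAt.const_mul c

/-- The Chernoff exponent is positive above the mean. -/
lemma exists_sum_mul_rpow_lt {ι : Type*} [Fintype ι] {c r : ι → ℝ} (h : ∀ i, c i ≠ 0 → 0 < r i)
    (hc : ∑ i, c i = 1) {t : ℝ} (ht : ∑ i, c i * Real.log (r i) < t) :
    ∃ s : ℝ, 0 < s ∧ ∑ i, c i * r i ^ s < Real.exp (s * t) := by
  have h1 : HasDerivAt (fun s : ℝ => ∑ i, c i * r i ^ s - Real.exp (s * t))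
      (∑ i, c i * Real.log (r i) - t) 0 := by
    refine (HasDerivAt.fun_sum fun i _ => hasDerivAt_mul_rpow (h i)).sub ?_
    simpa using ((hasDerivAt_id (0 : ℝ)).mul_const t).exp
  have h2 := h1.tendsto_slope_zero_right.eventually_lt_const (sub_neg.2 ht)
  obtain ⟨s, hs, hs0⟩ := (h2.and self_mem_nhdsWithin).exists
  refine ⟨s, hs0, ?_⟩
  have hs0' : 0 < s := hs0
  simp only [zero_add, Real.rpow_zero, mul_one, hc, zero_mul, Real.exp_zero, sub_self, sub_zero,
    smul_eq_mul] at hs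
  exact sub_neg.1 (neg_of_mul_neg_right hs (inv_pos.2 hs0').le)

lemma sum_pi_mul_sum_pairs_rpow {W X Y : Type*} [Fintype W] [Fintype X] [Fintype Y]
    {p : W → ℝ} {q : W → X × Y → ℝ} (hq : ∀ w z, 0 ≤ q w z) {π : X × Y → ℝ} (hπ : ∀ z, 0 ≤ π z)
    (n : ℕ) (s : ℝ) :
    ∑ v : Fin n → W, ∑ z : (Fin n → X) × (Fin n → Y), (∏ i, p (v i)) *
      ((∏ i, q (v i) (z.1 i, z.2 i)) * ((∏ i, q (v i) (z.1 i, z.2 i)) / prodDist π n z) ^ s) =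
      (∑ w, p w * ∑ z, q w z * (q w z / π z) ^ s) ^ n := by
  have h : ∀ (v : Fin n → W) (z : (Fin n → X) × (Fin n → Y)),
      (∏ i, q (v i) (z.1 i, z.2 i)) * ((∏ i, q (v i) (z.1 i, z.2 i)) / prodDist π n z) ^ s =
      ∏ i, q (v i) (z.1 i, z.2 i) * (q (v i) (z.1 i, z.2 i) / π (z.1 i, z.2 i)) ^ s :=
    fun v z => by
    rw [prodDist, ← Finset.prod_div_distrib, ← Real.finsetProd_rpow _ _ fun i _ =>
      div_nonneg (hq _ _) (hπ _), ← Finset.prod_mul_distrib]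
  simp only [h, ← Finset.mul_sum]
  have h2 := sum_pi_mul_prod (M := n) p fun _ w => ∑ z, q w z * (q w z / π z) ^ s
  simp only [Finset.prod_const, Finset.card_univ, Fintype.card_fin] at h2
  rw [← h2]
  refine Finset.sum_congr rfl fun v _ => ?_
  rw [sum_pairs_prod fun i z => q (v i) z * (q (v i) z / π z) ^ s]

/-- Achievability. -/
lemma exists_code_tendsto {W X Y : Type*} [Fintype W] [Fintype X] [Fintype Y] {π : X × Y → ℝ}
    (hπ : IsPMF π) {p : W → ℝ} {A : W → X → ℝ} {B : W → Y → ℝ} (hp : IsPMF p)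
    (hA : ∀ w, IsPMF (A w)) (hB : ∀ w, IsPMF (B w))
    (h : ∀ z, ∑ w, p w * prodPMF (A w) (B w) z = π z) {R : ℝ}
    (hR : ∑ z, negMulLog (π z) - ∑ w, p w * entropy (prodPMF (A w) (B w)) < R) :
    ∃ c : (n : ℕ) → SynthCode X Y (numMsgs R n) n,
      Tendsto (fun n => tvDist ((c n).induced) (prodDist π n)) atTop (nhds 0) := by
  obtain ⟨t, ht, htR⟩ := exists_between hR
  set q : W → X × Y → ℝ := fun w => prodPMF (A w) (B w) with hq
  have hq1 : ∀ w, IsPMF (q w) := fun w => (hA w).prod (hB w)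
  have hq0 : ∀ w z, 0 ≤ q w z := fun w => (hq1 w).1
  have hpos : ∀ w z, p w * q w z ≠ 0 → 0 < q w z ∧ 0 < π z := fun w z hne => by
    have h1 : 0 < q w z := lt_of_le_of_ne (hq0 w z) (right_ne_zero_of_mul hne).symm
    refine ⟨h1, ?_⟩
    rw [← h]
    exact Finset.sum_pos' (fun w _ => mul_nonneg (hp.1 w) (hq0 w z))
      ⟨w, Finset.mem_univ w, lt_of_le_of_ne (mul_nonneg (hp.1 w) (hq0 w z)) hne.symm⟩
  have hmean : ∑ x : W × (X × Y), p x.1 * q x.1 x.2 * Real.log (q x.1 x.2 / π x.2) =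
      ∑ z, negMulLog (π z) - ∑ w, p w * entropy (q w) := by
    have h1 : ∀ w z, p w * q w z * Real.log (q w z / π z) =
        - (p w * negMulLog (q w z)) - p w * q w z * Real.log (π z) := fun w z => by
      by_cases h0 : p w * q w z = 0
      · rcases mul_eq_zero.1 h0 with h0 | h0 <;> simp [h0]
      · obtain ⟨h2, h3⟩ := hpos w z h0
        rw [Real.log_div h2.ne' h3.ne', negMulLog]
        ring
    have h2 : ∑ w, ∑ z, p w * q w z * Real.log (π z) = - ∑ z, negMulLog (π z) := by
      rw [Finset.sum_comm, ← Finset.sum_neg_distrib]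
      refine Finset.sum_congr rfl fun z _ => ?_
      rw [← Finset.sum_mul, h, negMulLog]
      ring
    simp only [Fintype.sum_prod_type (α₁ := W), h1, Finset.sum_sub_distrib,
      Finset.sum_neg_distrib, h2, ← Finset.mul_sum, (hq1 _).entropy_eq]
    ring
  obtain ⟨s, hs, hG⟩ := exists_sum_mul_rpow_lt
    (c := fun x : W × (X × Y) => p x.1 * q x.1 x.2) (r := fun x => q x.1 x.2 / π x.2)
    (fun x hx => div_pos (hpos _ _ hx).1 (hpos _ _ hx).2)
    (by simp [Fintype.sum_prod_type (α₁ := W), ← Finset.mul_sum, (hq1 _).2, hp.2])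
    (hmean.trans_lt ht)
  set G := ∑ w, p w * ∑ z, q w z * (q w z / π z) ^ s with hGdef
  have hG' : G < Real.exp (s * t) := by
    convert hG using 1
    simp only [hGdef, Fintype.sum_prod_type (α₁ := W), Finset.mul_sum, mul_assoc]
  have hG0 : 0 ≤ G := Finset.sum_nonneg fun w _ => mul_nonneg (hp.1 w) <|
    Finset.sum_nonneg fun z _ => mul_nonneg (hq0 w z) <|
      Real.rpow_nonneg (div_nonneg (hq0 w z) (hπ.1 z)) _
  have hcode : ∀ n : ℕ, ∃ c : SynthCode X Y (numMsgs R n) n, tvDist c.induced (prodDist π n) ≤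
      (Real.exp (-(s * t)) * G) ^ n + Real.exp (-((R - t) / 2)) ^ n / 2 := fun n => by
    have hM := numMsgs_ne_zero R n
    have hK : ∀ v : Fin n → W, IsPMF
        (fun z : (Fin n → X) × (Fin n → Y) => ∏ i, q (v i) (z.1 i, z.2 i)) := fun v => by
      refine ⟨fun z => Finset.prod_nonneg fun i _ => hq0 _ _, ?_⟩
      rw [sum_pairs_prod fun i => q (v i)]
      simp [(hq1 _).2]
    obtain ⟨v, hv⟩ := exists_codebook (hp.pi n) hK hM (Real.exp_pos (n * t))
      (Real.exp_pos (-(n * ((R - t) / 2)))) hs.le (ρ := prodDist π n) fun z => by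
        rw [sum_pi_mul_prod p fun i w => q w (z.1 i, z.2 i)]
        simp only [prodDist, ← h, hq]
    have hAn : ∀ w : Fin n → W, IsPMF fun x : Fin n → X => ∏ i, A (w i) (x i) := fun w =>
      ⟨fun x => Finset.prod_nonneg fun i _ => (hA _).1 _, by
        simp [← Fintype.prod_sum fun i => A (w i), (hA _).2]⟩
    have hBn : ∀ w : Fin n → W, IsPMF fun x : Fin n → Y => ∏ i, B (w i) (x i) := fun w =>
      ⟨fun x => Finset.prod_nonneg fun i _ => (hB _).1 _, by
        simp [← Fintype.prod_sum fun i => B (w i), (hB _).2]⟩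
    refine ⟨⟨fun m x => ∏ i, A (v m i) (x i), fun m y => ∏ i, B (v m i) (y i),
      fun m => hAn (v m), fun m => hBn (v m)⟩, ?_⟩
    rw [sum_pi_mul_sum_pairs_rpow hq0 hπ.1 n s, ← hGdef] at hv
    simp only [tvDist, SynthCode.induced, ← Finset.prod_mul_distrib]
    simp only [hq, prodPMF] at hv
    rw [div_le_iff₀ two_pos]
    refine hv.trans ?_
    have h1 : Real.exp (n * t) ^ (-s) = Real.exp (-(s * t)) ^ n := by
      rw [← Real.exp_mul, ← Real.exp_nat_mul]
      congr 1
      ring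
    have h2 : Real.exp (-(n * ((R - t) / 2))) = Real.exp (-((R - t) / 2)) ^ n := by
      rw [← Real.exp_nat_mul]
      congr 1
      ring
    have h3 : Real.exp (n * t) / (Real.exp (-(n * ((R - t) / 2))) * numMsgs R n) ≤
        Real.exp (-((R - t) / 2)) ^ n := by
      have hle : Real.exp (n * R) ≤ numMsgs R n := Nat.le_ceil _
      calc _ ≤ Real.exp (n * t) / (Real.exp (-(n * ((R - t) / 2))) * Real.exp (n * R)) := by
            gcongr
        _ = Real.exp (-((R - t) / 2)) ^ n := by
            rw [← Real.exp_add, ← Real.exp_sub, ← Real.exp_nat_mul]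
            congr 1
            ring
    rw [h2] at h3 ⊢
    rw [h1, ← mul_pow]
    linarith
  choose c hc using hcode
  refine ⟨c, squeeze_zero (fun n => tvDist_nonneg _ _) hc ?_⟩
  have h1 : Real.exp (-(s * t)) * G < 1 := by
    calc _ < Real.exp (-(s * t)) * Real.exp (s * t) :=
          mul_lt_mul_of_pos_left hG' (Real.exp_pos _)
      _ = 1 := by rw [← Real.exp_add, neg_add_cancel, Real.exp_zero]
  have h2 : Real.exp (-((R - t) / 2)) < 1 := Real.exp_lt_one_iff.2 (by linarith)
  simpa using (tendsto_pow_atTop_nhds_zero_of_lt_one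
    (mul_nonneg (Real.exp_pos _).le hG0) h1).add
      ((tendsto_pow_atTop_nhds_zero_of_lt_one (Real.exp_pos _).le h2).div_const 2)

lemma exists_code_of_mem_wynerSet {X Y : Type*} [Fintype X] [Fintype Y] {π : X × Y → ℝ}
    (hπ : IsPMF π) {r R : ℝ} (hr : r ∈ wynerSet π) (hR : r < R) :
    ∃ c : (n : ℕ) → SynthCode X Y (numMsgs R n) n,
      limsup (fun n => tvDist ((c n).induced) (prodDist π n)) atTop = 0 := by
  obtain ⟨p, A, B, hp, hA, hB, h, rfl⟩ := exists_mixture_of_mem_wynerSet hr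
  obtain ⟨c, hc⟩ := exists_code_tendsto hπ hp hA hB h hR
  exact ⟨c, hc.limsup_eq⟩

/-- Common information under the TV distance: `T_ε^TV(π) = C_Wyner(X;Y)` for every
`ε ∈ [0,1)`, and `T_1^TV(π) = 0`.  In particular the strong converse property holds. -/
theorem common_information_under_TV
    {X Y : Type*} [Fintype X] [Fintype Y] (π : X × Y → ℝ) (hπ : IsPMF π) :
    (∀ ε ∈ Set.Ico (0 : ℝ) 1, Ttv π ε = CWyner π) ∧ Ttv π 1 = 0 := by
  have hbdd : ∀ ε, BddBelow { R : ℝ | 0 ≤ R ∧ ∃ c : (n : ℕ) → SynthCode X Y (numMsgs R n) n,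
      Filter.limsup (fun n => tvDist ((c n).induced) (prodDist π n)) atTop ≤ ε } :=
    fun ε => ⟨0, fun R hR => hR.1⟩
  refine ⟨fun ε hε => le_antisymm ?_ ?_, le_antisymm ?_ ?_⟩
  · refine le_csInf (wynerSet_nonempty hπ) fun r hr =>
      le_of_forall_gt_imp_ge_of_dense fun R hR => ?_
    obtain ⟨c, hc⟩ := exists_code_of_mem_wynerSet hπ hr hR
    exact csInf_le (hbdd ε) ⟨(nonneg_of_mem_wynerSet hr).trans hR.le, c, hc.trans_le hε.1⟩
  · obtain ⟨r, hr⟩ := wynerSet_nonempty hπ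
    obtain ⟨c, hc⟩ := exists_code_of_mem_wynerSet hπ hr (lt_add_one r)
    refine le_csInf ⟨r + 1, add_nonneg (nonneg_of_mem_wynerSet hr) zero_le_one, c,
      hc.trans_le hε.1⟩ fun R hR => ?_
    obtain ⟨hR0, c, hc⟩ := hR
    obtain ⟨r, hr, hrR⟩ := exists_mem_wynerSet_le_rate hπ hε.2 hR0 c hc
    exact (csInf_le ⟨0, fun _ => nonneg_of_mem_wynerSet⟩ hr).trans hrR
  · obtain ⟨⟨x, y⟩⟩ := hπ.nonempty
    have : Nonempty X := ⟨x⟩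
    have : Nonempty Y := ⟨y⟩
    choose A hA using fun n : ℕ => exists_isPMF (Fin n → X)
    choose B hB using fun n : ℕ => exists_isPMF (Fin n → Y)
    refine csInf_le (hbdd 1) ⟨le_rfl, fun n => ⟨fun _ => A n, fun _ => B n, fun _ => hA n,
      fun _ => hB n⟩, ?_⟩
    exact limsup_le_of_le ⟨0, fun b hb => by
      obtain ⟨n, hn⟩ := (eventually_map.1 hb).exists
      exact (tvDist_nonneg _ _).trans hn⟩ (.of_forall fun n => tvDist_code_le_one hπ _)
  · exact Real.sInf_nonneg fun R hR => hR.1
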